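/- Let n ≥ 2 be an integer and let f ∈ ℤ[X] be squarefree (in ℚ[X]) with deg f ≥ 3. Suppose the equation y^n = f(x) is everywhere locally soluble, i.e. it has an ℝ-point and a ℚ_p-point for every prime p. Then there exist a real γ with 0 ≤ γ < 1, a constant c > 0 and X₀ such that for all real X ≥ X₀, the number of n-th power free integers d with |d| ≤ X for which the twist C_d : d·y^n = f(x) is everywhere locally soluble is at least c·X/(log X)^γ. -/

import Mathlib

open Polynomial

/-- The radical of an integer: the product of its distinct prime factors. -/
def IntRadical (m : ℤ) : ℕ := ∏ p ∈ m.natAbs.primeFactors, p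

/-- The abc conjecture of Masser–Oesterlé. -/
def ABCConjecture : Prop :=
  ∀ ε : ℝ, 0 < ε → ∃ K : ℝ, 0 < K ∧ ∀ a b c : ℤ,
    a ≠ 0 → b ≠ 0 → c ≠ 0 →
    IsCoprime a b → IsCoprime a c → IsCoprime b c →
    a + b = c →
    ((max (max |a| |b|) |c| : ℤ) : ℝ) ≤ K * (IntRadical (a * b * c) : ℝ) ^ (1 + ε)

/-- `d` is `n`-th power free. -/
def NthPowerFree (n : ℕ) (d : ℤ) : Prop :=
  d ≠ 0 ∧ ∀ p : ℕ, p.Prime → ¬ ((p : ℤ) ^ n ∣ d)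

/-- A `K`-point of the twist `C_d : d·y^n = f(x)`. -/
def HasTwistPoint (n : ℕ) (f : Polynomial ℤ) (d : ℤ) (K : Type) [CommRing K] : Prop :=
  ∃ x y : K, (d : K) * y ^ n = Polynomial.aeval x f

/-- The twist `C_d : d·y^n = f(x)` has points everywhere locally. -/
def EverywhereLocallySoluble (n : ℕ) (f : Polynomial ℤ) (d : ℤ) : Prop :=
  HasTwistPoint n f d ℝ ∧ ∀ (p : ℕ) (_ : Fact p.Prime), HasTwistPoint n f d ℚ_[p]

/-- The twist `C_d` violates the Hasse principle. -/
def ViolatesHasse (n : ℕ) (f : Polynomial ℤ) (d : ℤ) : Prop :=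
  EverywhereLocallySoluble n f d ∧ ¬ HasTwistPoint n f d ℚ

/-- `f` is weakly intersective: the primes modulo which `f` has a root have
relative natural density `1` in the primes. -/
def WeaklyIntersective (f : Polynomial ℤ) : Prop :=
  Filter.Tendsto (fun X : ℕ =>
      (Nat.card {ℓ : ℕ // ℓ ≤ X ∧ ℓ.Prime ∧ ∃ x : ZMod ℓ, Polynomial.aeval x f = 0} : ℝ) /
      (Nat.card {ℓ : ℕ // ℓ ≤ X ∧ ℓ.Prime} : ℝ))
    Filter.atTop (nhds 1)

section Stepanov

variable {L : Type*} [Field L]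

/-- Terms `k s * X ^ E s * v s` whose valuations at `0` lie in disjoint windows of length `b`
cannot cancel. -/
theorem eq_zero_of_sum_eq_zero_of_gaps {ι : Type*} (S : Finset ι) (E : ι → ℕ) (b : ℕ)
    (hE : ∀ s ∈ S, ∀ t ∈ S, s ≠ t → E s + b ≤ E t ∨ E t + b ≤ E s) (k v : ι → L[X])
    (hk : ∀ s ∈ S, k s ∈ degreeLT L b) (hv : ∀ s ∈ S, (v s).eval 0 ≠ 0)
    (hsum : ∑ s ∈ S, k s * X ^ E s * v s = 0) : ∀ s ∈ S, k s = 0 := by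
  classical
  by_contra! hne
  have hT : (S.filter fun s => k s ≠ 0).Nonempty := by
    obtain ⟨s, hs, h⟩ := hne
    exact ⟨s, by simp [hs, h]⟩
  obtain ⟨s, hs, hmin⟩ := Finset.exists_min_image _ E hT
  simp only [Finset.mem_filter] at hs hmin
  have hdvd : (X : L[X]) ^ (E s + b) ∣ k s * X ^ E s * v s := by
    rw [← Finset.add_sum_erase _ _ hs.1] at hsum
    rw [eq_neg_of_add_eq_zero_left hsum, dvd_neg]
    refine Finset.dvd_sum fun t ht => ?_
    rw [Finset.mem_erase] at ht
    by_cases h0 : k t = 0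
    · simp [h0]
    · refine Dvd.dvd.mul_right (Dvd.dvd.mul_left (pow_dvd_pow _ ?_) _) _
      rcases hE s hs.1 t ht.2 ht.1.symm with h | h
      · exact h
      · have := hmin t ⟨ht.2, h0⟩
        omega
  have h1 : (X : L[X]) ^ b ∣ k s * v s := by
    have : k s * X ^ E s * v s = X ^ E s * (k s * v s) := by ring
    rw [this, pow_add] at hdvd
    exact (mul_dvd_mul_iff_left (pow_ne_zero _ X_ne_zero)).1 hdvd
  have hco : IsCoprime ((X : L[X]) ^ b) (v s) := by
    refine IsCoprime.pow_left ((irreducible_X.coprime_iff_not_dvd).2 ?_)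
    rw [X_dvd_iff, coeff_zero_eq_eval_zero]
    exact hv s hs.1
  have h2 := hco.dvd_of_dvd_mul_right h1
  refine hs.2 (eq_zero_of_dvd_of_degree_lt h2 ?_)
  rw [degree_X_pow]
  exact mem_degreeLT.1 (hk s hs.1)

/-- The derivation `f · d/dX`. -/
noncomputable def scaledDeriv (f : L[X]) : L[X] →ₗ[L] L[X] :=
  LinearMap.mulLeft L f ∘ₗ (derivative : L[X] →ₗ[L] L[X])

/-- The operator `k ↦ f k' + c f' k` induced by `f · d/dX` on coefficients of `f ^ c`. -/
noncomputable def twistedDeriv (f : L[X]) (c : ℕ) : L[X] →ₗ[L] L[X] :=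
  LinearMap.mulLeft L f ∘ₗ (derivative : L[X] →ₗ[L] L[X]) +
    LinearMap.mulLeft L ((c : L[X]) * derivative f)

theorem scaledDeriv_apply (f P : L[X]) : scaledDeriv f P = f * derivative P := rfl

theorem twistedDeriv_apply (f P : L[X]) (c : ℕ) :
    twistedDeriv f c P = f * derivative P + c * derivative f * P := rfl

theorem scaledDeriv_mul_pow (p : ℕ) [CharP L p] (f k : L[X]) (c j : ℕ) :
    scaledDeriv f (k * X ^ (j * p) * f ^ c) = twistedDeriv f c k * X ^ (j * p) * f ^ c := by
  have hX : derivative ((X : L[X]) ^ (j * p)) = 0 := by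
    rw [derivative_X_pow]
    simp
  have hf : f * derivative (f ^ c) = c * derivative f * f ^ c := by
    rcases c with _ | c
    · simp
    · rw [derivative_pow_succ]
      push_cast
      simp
      ring
  rw [scaledDeriv_apply, twistedDeriv_apply, derivative_mul, derivative_mul, hX]
  linear_combination k * X ^ (j * p) * hf

theorem scaledDeriv_iterate (p : ℕ) [CharP L p] (f k : L[X]) (c j m : ℕ) :
    (scaledDeriv f)^[m] (k * X ^ (j * p) * f ^ c) =
      (twistedDeriv f c)^[m] k * X ^ (j * p) * f ^ c := by
  induction m generalizing k with
  | zero => rfl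
  | succ m ih => rw [Function.iterate_succ_apply, scaledDeriv_mul_pow, ih,
      Function.iterate_succ_apply]

theorem mem_degreeLT_of_natDegree_lt {P : L[X]} {N : ℕ} (h : P.natDegree < N) :
    P ∈ degreeLT L N :=
  mem_degreeLT.2 (lt_of_le_of_lt degree_le_natDegree (by exact_mod_cast h))

theorem natDegree_lt_of_mem_degreeLT {P : L[X]} {N : ℕ} (hN : 0 < N) (h : P ∈ degreeLT L N) :
    P.natDegree < N := by
  rcases eq_or_ne P 0 with rfl | h0
  · simpa using hN
  · exact (natDegree_lt_iff_degree_lt h0).2 (mem_degreeLT.1 h)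

theorem twistedDeriv_mem (f : L[X]) {D : ℕ} (hD : f.natDegree ≤ D) (c : ℕ) {a : ℕ} {k : L[X]}
    (hk : k ∈ degreeLT L a) : twistedDeriv f c k ∈ degreeLT L (a + D) := by
  rcases Nat.eq_zero_or_pos a with rfl | ha
  · have h0 : k = 0 := by simpa [mem_degreeLT] using hk
    rw [h0, map_zero]
    exact zero_mem _
  have hka := natDegree_lt_of_mem_degreeLT ha hk
  rw [twistedDeriv_apply]
  have h1 := natDegree_derivative_le k
  have h2 := natDegree_derivative_le f
  refine add_mem (mem_degreeLT_of_natDegree_lt ?_) (mem_degreeLT_of_natDegree_lt ?_)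
  · refine natDegree_mul_le.trans_lt ?_
    omega
  · refine natDegree_mul_le.trans_lt ?_
    have h3 : ((c : L[X]) * derivative f).natDegree ≤ (derivative f).natDegree := by
      refine natDegree_mul_le.trans ?_
      simp
    omega

theorem twistedDeriv_iterate_mem (f : L[X]) {D : ℕ} (hD : f.natDegree ≤ D) (c : ℕ) {a : ℕ}
    {k : L[X]} (hk : k ∈ degreeLT L a) (m : ℕ) :
    (twistedDeriv f c)^[m] k ∈ degreeLT L (a + m * D) := by
  induction m with
  | zero => simpa using hk
  | succ m ih =>
    rw [Function.iterate_succ_apply']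
    convert twistedDeriv_mem f hD c ih using 2
    ring

theorem eval_scaledDeriv_iterate (f S : L[X]) (x : L) (m : ℕ) :
    ((scaledDeriv f)^[m] ((X - C x) ^ m * S)).eval x =
      (m.factorial : L) * f.eval x ^ m * S.eval x := by
  induction m generalizing S with
  | zero => simp
  | succ m ih =>
    have : scaledDeriv f ((X - C x) ^ (m + 1) * S) =
        (X - C x) ^ m * ((m + 1 : L[X]) * f * S + (X - C x) * (f * derivative S)) := by
      rw [scaledDeriv_apply, derivative_mul, derivative_pow_succ]
      simp
      ring
    rw [Function.iterate_succ_apply, this, ih]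
    simp [Nat.factorial_succ]
    ring

/-- If the first `M ≤ p` iterates of `f · d/dX` on `R` vanish at `x` and `f x ≠ 0`, then `R`
vanishes at `x` to order at least `M`. -/
theorem pow_dvd_of_scaledDeriv_iterate_eq_zero (p : ℕ) [CharP L p] (hp : p.Prime) (f R : L[X])
    (x : L) (hx : f.eval x ≠ 0) (M : ℕ) (hM : M ≤ p)
    (h : ∀ m < M, ((scaledDeriv f)^[m] R).eval x = 0) : (X - C x) ^ M ∣ R := by
  induction M with
  | zero => simp
  | succ M ih =>
    obtain ⟨S, rfl⟩ := ih (by omega) fun m hm => h m (by omega)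
    have h1 := h M (by omega)
    rw [eval_scaledDeriv_iterate] at h1
    have hfac : (M.factorial : L) ≠ 0 := by
      rw [Ne, CharP.cast_eq_zero_iff L p, hp.dvd_factorial]
      omega
    have hS : S.eval x = 0 := by
      simpa [hfac, hx] using h1
    rw [pow_succ]
    exact mul_dvd_mul_left _ (dvd_iff_isRoot.2 hS)

theorem mul_card_le_natDegree_of_pow_dvd (Z : Finset L) (M : ℕ) (R : L[X]) (hR : R ≠ 0)
    (h : ∀ z ∈ Z, (X - C z) ^ M ∣ R) : M * Z.card ≤ R.natDegree := by
  have hd : ∏ z ∈ Z, (X - C z) ^ M ∣ R := by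
    refine Finset.prod_dvd_of_coprime (fun a _ b _ hab => ?_) h
    exact (isCoprime_X_sub_C_of_isUnit_sub (sub_ne_zero.2 hab).isUnit).pow
  have := natDegree_le_of_dvd hd hR
  rw [natDegree_prod_of_monic _ _ fun z _ => (monic_X_sub_C z).pow M] at this
  simpa [mul_comm] using this

/-- **Stepanov's bound.** If `f` has a simple zero at `0`, then `f ^ b` takes a given value at
few solutions of `z ^ p = z + β`. -/
theorem stepanov_bound (p : ℕ) [CharP L p] (hp : p.Prime) (f : L[X]) {D : ℕ}
    (hD : f.natDegree ≤ D) (hf0 : f.eval 0 = 0) (hf1 : (derivative f).eval 0 ≠ 0)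
    {e b : ℕ} (heb : e * b = p - 1) (ζ β : L) (Z : Finset L)
    (hZ : ∀ z ∈ Z, f.eval z ≠ 0 ∧ f.eval z ^ b = ζ ∧ z ^ p = z + β)
    {M J : ℕ} (hM : M ≤ p) (hMJ : M * (b + J + M * D) < e * (J * b)) :
    M * Z.card ≤ b + J * p + e * b * D - p := by
  classical
  have hb : 0 < b := by
    rcases Nat.eq_zero_or_pos b with rfl | h
    · simp at hMJ
    · exact h
  have hJ : 0 < J := by
    rcases Nat.eq_zero_or_pos J with rfl | h
    · simp at hMJ
    · exact h
  have he : 0 < e := by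
    rcases Nat.eq_zero_or_pos e with rfl | h
    · simp at hMJ
    · exact h
  obtain ⟨u, hu⟩ : X ∣ f := by
    rwa [X_dvd_iff, coeff_zero_eq_eval_zero]
  have hu0 : u.eval 0 ≠ 0 := by
    rw [hu] at hf1
    simpa using hf1
  let V := Fin e → Fin J → degreeLT L b
  let W := Fin M → degreeLT L (b + J + M * D)
  let proj (i : Fin e) (j : Fin J) : V →ₗ[L] L[X] := (degreeLT L b).subtype ∘ₗ
    (LinearMap.proj j : (Fin J → degreeLT L b) →ₗ[L] degreeLT L b) ∘ₗ
    (LinearMap.proj i : V →ₗ[L] (Fin J → degreeLT L b))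
  have hproj (i : Fin e) (j : Fin J) (k : V) : proj i j k = (k i j : L[X]) := rfl
  let Ψ (m : ℕ) : V →ₗ[L] L[X] := ∑ i : Fin e, ∑ j : Fin J,
    LinearMap.mulLeft L (C ζ ^ (i : ℕ) * (X + C β) ^ (j : ℕ)) ∘ₗ
      ((twistedDeriv f (b * i) ^ m : L[X] →ₗ[L] L[X])) ∘ₗ proj i j
  have hΨ (m : ℕ) (k : V) : Ψ m k = ∑ i : Fin e, ∑ j : Fin J,
      C ζ ^ (i : ℕ) * (X + C β) ^ (j : ℕ) * (twistedDeriv f (b * i))^[m] (k i j) := by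
    simp only [Ψ, LinearMap.sum_apply, LinearMap.comp_apply, LinearMap.mulLeft_apply, hproj,
      Module.End.pow_apply]
  have hΨmem (m : Fin M) (k : V) : Ψ m k ∈ degreeLT L (b + J + M * D) := by
    rw [hΨ]
    refine sum_mem fun i _ => sum_mem fun j _ => ?_
    have h1 := twistedDeriv_iterate_mem f hD (b * i) (k i j).2 (m : ℕ)
    have h2 := natDegree_lt_of_mem_degreeLT (by omega) h1
    refine mem_degreeLT_of_natDegree_lt (natDegree_mul_le.trans_lt ?_)
    have h3 : (C ζ ^ (i : ℕ) * (X + C β) ^ (j : ℕ)).natDegree ≤ (j : ℕ) := by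
      rw [← C_pow]
      refine natDegree_C_mul_le _ _ |>.trans ?_
      rw [natDegree_pow, natDegree_X_add_C, mul_one]
    have h4 : (m : ℕ) * D ≤ M * D := Nat.mul_le_mul_right _ m.2.le
    have := j.2
    omega
  let Φ : V →ₗ[L] W := LinearMap.pi fun m => LinearMap.codRestrict _ (Ψ m) (hΨmem m)
  have hdim : Module.finrank L W < Module.finrank L V := by
    simp only [V, W, Module.finrank_pi_fintype, (degreeLTEquiv L _).finrank_eq]
    simpa using hMJ
  obtain ⟨k, hk, hk0⟩ :=
    (Submodule.ne_bot_iff _).1 (LinearMap.ker_ne_bot_of_finrank_lt hdim (f := Φ))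
  let R : L[X] := ∑ i : Fin e, ∑ j : Fin J, (k i j : L[X]) * X ^ ((j : ℕ) * p) * f ^ (b * (i : ℕ))
  have hR : R ≠ 0 := by
    intro hR0
    refine hk0 (funext fun i => funext fun j => ?_)
    have := eq_zero_of_sum_eq_zero_of_gaps (Finset.univ : Finset (Fin e × Fin J))
      (fun s => s.2 * p + s.1 * b) b ?_ (fun s => k s.1 s.2) (fun s => u ^ (b * (s.1 : ℕ)))
      (fun s _ => (k s.1 s.2).2) (fun s _ => by simpa using fun h => absurd h hu0) ?_ (i, j)
      (Finset.mem_univ _)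
    · exact Subtype.ext this
    · rintro ⟨i, j⟩ - ⟨i', j'⟩ - hne
      have hp1 := hp.one_lt
      have key : ∀ (i i' : Fin e) (j j' : Fin J), j < j' →
          (j : ℕ) * p + i * b + b ≤ j' * p + i' * b := by
        intro i i' j j' hj
        have h1 : ((i : ℕ) + 1) * b ≤ e * b := Nat.mul_le_mul_right _ i.2
        have h2 : ((j : ℕ) + 1) * p ≤ j' * p := Nat.mul_le_mul_right _ hj
        rw [add_mul] at h1 h2
        omega
      have key2 : ∀ (i i' : Fin e), i < i' → (i : ℕ) * b + b ≤ i' * b := by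
        intro i i' hi
        have h2 : ((i : ℕ) + 1) * b ≤ i' * b := Nat.mul_le_mul_right _ hi
        rw [add_mul] at h2
        omega
      rcases lt_trichotomy j j' with h | rfl | h
      · exact Or.inl (key _ _ _ _ h)
      · rcases lt_trichotomy i i' with h | rfl | h
        · left
          have := key2 _ _ h
          simp only
          omega
        · exact absurd rfl hne
        · right
          have := key2 _ _ h
          simp only
          omega
      · exact Or.inr (key _ _ _ _ h)
    · rw [Fintype.sum_prod_type, ← hR0]
      refine Finset.sum_congr rfl fun i _ => Finset.sum_congr rfl fun j _ => ?_
      rw [hu, mul_pow, pow_add, mul_comm (i : ℕ) b]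
      ring
  have hvan : ∀ z ∈ Z, (X - C z) ^ M ∣ R := by
    intro z hz
    obtain ⟨hz0, hzb, hzp⟩ := hZ z hz
    refine pow_dvd_of_scaledDeriv_iterate_eq_zero p hp f R z hz0 M hM fun m hm => ?_
    have h1 : Ψ m k = 0 :=
      congrArg Subtype.val (congrFun (LinearMap.mem_ker.1 hk) (⟨m, hm⟩ : Fin M))
    rw [← eval_zero (x := z), ← h1, hΨ]
    simp only [R, ← Module.End.pow_apply, map_sum, eval_finsetSum]
    refine Finset.sum_congr rfl fun i _ => Finset.sum_congr rfl fun j _ => ?_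
    simp only [Module.End.pow_apply]
    rw [scaledDeriv_iterate]
    simp only [eval_mul, eval_pow, eval_X, eval_C, eval_add]
    rw [pow_mul (eval z f), hzb, mul_comm (j : ℕ) p, pow_mul, hzp]
    ring
  refine (mul_card_le_natDegree_of_pow_dvd Z M R hR hvan).trans ?_
  refine natDegree_sum_le_of_forall_le _ _ fun i _ =>
    natDegree_sum_le_of_forall_le _ _ fun j _ => ?_
  have h1 := natDegree_lt_of_mem_degreeLT hb (k i j).2
  have h2 : ((k i j : L[X]) * X ^ ((j : ℕ) * p) * f ^ (b * (i : ℕ))).natDegree ≤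
      (k i j : L[X]).natDegree + j * p + b * i * D := by
    refine natDegree_mul_le.trans (add_le_add (natDegree_mul_le.trans ?_) ?_)
    · simp
    · exact natDegree_pow_le.trans (Nat.mul_le_mul_left _ hD)
  have h3 : ((j : ℕ) + 1) * p ≤ J * p := Nat.mul_le_mul_right _ j.2
  have h4 : b * i * D ≤ e * b * D := by
    rw [mul_comm b]
    exact Nat.mul_le_mul_right _ (Nat.mul_le_mul_right _ i.2.le)
  rw [add_mul] at h3
  omega

theorem card_filter_eval_pow_eq_le (p : ℕ) [Fact p.Prime] (f : (ZMod p)[X]) {D : ℕ}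
    (hD : f.natDegree ≤ D) (hd : 0 < f.natDegree) (hf : f.Separable) {e b : ℕ}
    (heb : e * b = p - 1) (ζ : ZMod p) {l : ℕ} (hl : l * (l + 1 + e * l * D) < b) :
    e * l * (Finset.univ.filter fun x : ZMod p => f.eval x ≠ 0 ∧ f.eval x ^ b = ζ).card ≤
      (l + D + 1) * p := by
  classical
  have hp : p.Prime := Fact.out
  let K := AlgebraicClosure (ZMod p)
  have : CharP K p := charP_of_injective_algebraMap (algebraMap (ZMod p) K).injective p
  let i := algebraMap (ZMod p) K
  obtain ⟨α, hα⟩ := IsAlgClosed.exists_root (f.map i) (by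
    rw [degree_map]
    exact (natDegree_pos_iff_degree_pos.1 hd).ne')
  let g : K[X] := (f.map i).comp (X + C α)
  have hgD : g.natDegree ≤ D := by
    rw [natDegree_comp, natDegree_X_add_C, mul_one, natDegree_map]
    exact hD
  have hg (x : K) : g.eval x = (f.map i).eval (x + α) := by simp [g]
  have hg0 : g.eval 0 = 0 := by
    rw [hg, zero_add]
    exact hα
  have hg1 : (derivative g).eval 0 ≠ 0 := by
    have hne := (hf.map (f := i)).eval₂_derivative_ne_zero (RingHom.id K) (x := α)
      (by simpa using hα)
    rw [derivative_comp]
    simpa using hne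
  let Z₀ := Finset.univ.filter fun x : ZMod p => f.eval x ≠ 0 ∧ f.eval x ^ b = ζ
  let Z : Finset K := Z₀.image fun x => i x - α
  have hcard : Z.card = Z₀.card :=
    Finset.card_image_of_injective _ fun x y h => i.injective (sub_left_injective h)
  have hZ : ∀ z ∈ Z, g.eval z ≠ 0 ∧ g.eval z ^ b = i ζ ∧ z ^ p = z + (α - α ^ p) := by
    intro z hz
    obtain ⟨x, hx, rfl⟩ := Finset.mem_image.1 hz
    obtain ⟨hx0, hxb⟩ := (Finset.mem_filter.1 hx).2
    have h1 : g.eval (i x - α) = i (f.eval x) := by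
      rw [hg, sub_add_cancel, eval_map, eval₂_at_apply]
    refine ⟨?_, ?_, ?_⟩
    · rw [h1]
      simpa using hx0
    · rw [h1, ← map_pow, hxb]
    · rw [sub_pow_char, ← map_pow, ZMod.pow_card]
      ring
  rcases Nat.eq_zero_or_pos l with rfl | hl0
  · simp
  have hlb : l < b := lt_of_le_of_lt (Nat.le_mul_of_pos_right _ (by omega)) hl
  have he : 0 < e := by
    rcases Nat.eq_zero_or_pos e with rfl | h
    · have := hp.two_le
      omega
    · exact h
  have hp1 := hp.two_le
  have key := stepanov_bound p hp g hgD hg0 hg1 heb (i ζ) (α - α ^ p) Z hZ (M := e * l)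
    (J := l + 1) (by
      have : e * l ≤ e * b := Nat.mul_le_mul_left _ hlb.le
      omega) (by
      have := Nat.mul_lt_mul_of_pos_left hl he
      linarith)
  rw [hcard] at key
  refine key.trans ?_
  have h1 : e * b * D ≤ p * D := Nat.mul_le_mul_right _ (by omega)
  have h2 : b ≤ p := by
    have : 1 * b ≤ e * b := Nat.mul_le_mul_right _ he
    omega
  rw [Nat.sub_le_iff_le_add]
  nlinarith

theorem stepanov_parameters_bound {p n D e b : ℕ} (hen : e ≤ n) (hb : p - 1 = e * b)
    (hp : (n * (D + 1) + n + 1) ^ 5 < p) :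
    e * (D + 1) * (e * (D + 1) + 1 + e * (e * (D + 1)) * D) < b := by
  by_contra! hle
  have h1 : p ≤ e * (e * (D + 1) * (e * (D + 1) + 1 + e * (e * (D + 1)) * D)) + 1 := by
    have := Nat.mul_le_mul_left e hle
    omega
  set A := n * (D + 1) with hA
  have h2 : e * (D + 1) ≤ A := Nat.mul_le_mul_right _ hen
  have h3 : e * D ≤ A := (Nat.mul_le_mul_left _ (by omega)).trans h2
  have h4 : e * (e * (D + 1)) * D ≤ A * A := by
    have : e * (e * (D + 1)) * D = e * (D + 1) * (e * D) := by ring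
    rw [this]
    exact Nat.mul_le_mul h2 h3
  have h5 : e * (e * (D + 1) * (e * (D + 1) + 1 + e * (e * (D + 1)) * D)) ≤
      n * (A * (A + 1 + A * A)) :=
    Nat.mul_le_mul hen (Nat.mul_le_mul h2 (by omega))
  have h6 : A * (A + 1 + A * A) ≤ (A + 1) ^ 4 := by
    have : (A + 1) ^ 4 = A * (A + 1 + A * A) + (A ^ 4 + 3 * A ^ 3 + 5 * A ^ 2 + 3 * A + 1) := by
      ring
    omega
  have h7 : n * (A * (A + 1 + A * A)) + 1 ≤ (A + n + 1) ^ 5 := by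
    have h8 : (A + 1) ^ 4 * (n + 1) ≤ (A + n + 1) ^ 5 := by
      rw [pow_succ (A + n + 1) 4]
      exact Nat.mul_le_mul (Nat.pow_le_pow_left (by omega) 4) (by omega)
    have h9 := Nat.mul_le_mul_left n h6
    have h10 : 1 ≤ (A + 1) ^ 4 := Nat.one_le_pow _ _ (by omega)
    have h11 : (A + 1) ^ 4 * (n + 1) = n * (A + 1) ^ 4 + (A + 1) ^ 4 := by ring
    omega
  omega

theorem exists_pow_eq_of_pow_eq_one {G : Type*} [CommGroup G] [IsCyclic G] [Finite G] {n b : ℕ}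
    (hb : Nat.card G = n.gcd (Nat.card G) * b) {t : G} (ht : t ^ b = 1) : ∃ y : G, y ^ n = t := by
  have hN : 0 < Nat.card G := Nat.card_pos
  have he : 0 < n.gcd (Nat.card G) := Nat.gcd_pos_of_pos_right _ hN
  have hle : (powMonoidHom n : G →* G).range ≤ (powMonoidHom b : G →* G).ker := by
    rintro _ ⟨y, rfl⟩
    obtain ⟨c, hc⟩ := Nat.gcd_dvd_left n (Nat.card G)
    rw [MonoidHom.mem_ker, powMonoidHom_apply, powMonoidHom_apply, ← pow_mul]
    have : n * b = Nat.card G * c := by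
      conv_lhs => rw [hc]
      conv_rhs => rw [hb]
      ring
    rw [this, pow_mul, pow_card_eq_one', one_pow]
  have hcard : Nat.card (powMonoidHom b : G →* G).ker ≤ Nat.card (powMonoidHom n : G →* G).range := by
    rw [IsCyclic.card_powMonoidHom_range, IsCyclic.card_powMonoidHom_ker,
      Nat.gcd_eq_right (Dvd.intro_left _ hb.symm), Nat.gcd_comm _ n]
    refine (Nat.le_div_iff_mul_le he).2 ?_
    rw [mul_comm]
    exact hb.ge
  have heq := Subgroup.eq_of_le_of_card_ge hle hcard
  have : t ∈ (powMonoidHom b : G →* G).ker := ht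
  rw [← heq] at this
  exact this

/-- For large `p`, a separable polynomial over `𝔽_p` takes nonzero values in every coset of the
`n`-th powers. -/
theorem exists_eval_eq_mul_pow (p : ℕ) [Fact p.Prime] {n D : ℕ} (hn : 0 < n)
    (hp : (n * (D + 1) + n + 1) ^ 5 < p) (f : (ZMod p)[X]) (hD : f.natDegree ≤ D)
    (hd : 0 < f.natDegree) (hf : f.Separable) {a : ZMod p} (ha : a ≠ 0) :
    ∃ x y : ZMod p, y ≠ 0 ∧ a * y ^ n = f.eval x := by
  classical
  have hp2 : 2 ≤ p := (Fact.out : p.Prime).two_le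
  let e := n.gcd (p - 1)
  obtain ⟨b, hb⟩ : e ∣ p - 1 := Nat.gcd_dvd_right _ _
  have hen : e ≤ n := Nat.gcd_le_left _ hn
  have he : 0 < e := Nat.gcd_pos_of_pos_left _ hn
  let l := e * (D + 1)
  have hln : l ≤ n * (D + 1) := Nat.mul_le_mul_right _ hen
  have hl : l * (l + 1 + e * l * D) < b := stepanov_parameters_bound hen hb hp
  by_contra! hno
  let Z (ζ : ZMod p) := Finset.univ.filter fun x : ZMod p => f.eval x ≠ 0 ∧ f.eval x ^ b = ζ
  let μ := (nthRoots e (1 : ZMod p)).toFinset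
  have hμ : μ.card ≤ e := (Multiset.toFinset_card_le _).trans (card_nthRoots e 1)
  have hpow (t : ZMod p) (ht : t ≠ 0) : t ^ b ∈ μ := by
    rw [Multiset.mem_toFinset, mem_nthRoots he, ← pow_mul, mul_comm, ← hb]
    exact ZMod.pow_card_sub_one_eq_one ht
  have hempty : ∀ x : ZMod p, f.eval x ≠ 0 → f.eval x ^ b ≠ a ^ b := by
    intro x hx hxb
    have ht : f.eval x / a ≠ 0 := div_ne_zero hx ha
    have h1 : (f.eval x / a) ^ b = 1 := by
      rw [div_pow, hxb, div_self (pow_ne_zero _ ha)]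
    obtain ⟨y, hy⟩ : ∃ y : (ZMod p)ˣ, y ^ n = Units.mk0 _ ht := by
      have hN : Nat.card (ZMod p)ˣ = p - 1 := by
        rw [Nat.card_eq_fintype_card, ZMod.card_units]
      exact exists_pow_eq_of_pow_eq_one (b := b) (by rw [hN]; exact hb) (Units.ext h1)
    have hy' : (y : ZMod p) ^ n = f.eval x / a := by
      rw [← Units.val_pow_eq_pow_val, hy, Units.val_mk0]
    refine hno x y y.ne_zero ?_
    rw [hy']
    field_simp
  have hcover : Finset.univ ⊆ f.roots.toFinset ∪ (μ.erase (a ^ b)).biUnion Z := by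
    intro x _
    rw [Finset.mem_union]
    by_cases hx : f.eval x = 0
    · left
      rw [Multiset.mem_toFinset, mem_roots (by rintro rfl; simp at hd)]
      exact hx
    · right
      rw [Finset.mem_biUnion]
      exact ⟨f.eval x ^ b, Finset.mem_erase.2 ⟨hempty x hx, hpow _ hx⟩, by simp [Z, hx]⟩
  have h1 := Finset.card_le_card hcover
  rw [Finset.card_univ, ZMod.card] at h1
  have h2 : f.roots.toFinset.card ≤ D :=
    (Multiset.toFinset_card_le _).trans ((card_roots' f).trans hD)
  have h3 : (μ.erase (a ^ b)).card ≤ e - 1 := by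
    rw [Finset.card_erase_of_mem (hpow a ha)]
    omega
  have h4 : e * l * ((μ.erase (a ^ b)).biUnion Z).card ≤ (e - 1) * ((l + D + 1) * p) := by
    calc e * l * ((μ.erase (a ^ b)).biUnion Z).card
        ≤ e * l * ∑ ζ ∈ μ.erase (a ^ b), (Z ζ).card := Nat.mul_le_mul_left _ Finset.card_biUnion_le
      _ = ∑ ζ ∈ μ.erase (a ^ b), e * l * (Z ζ).card := Finset.mul_sum _ _ _
      _ ≤ ∑ ζ ∈ μ.erase (a ^ b), (l + D + 1) * p :=
        Finset.sum_le_sum fun ζ _ => card_filter_eval_pow_eq_le p f hD hd hf hb.symm ζ hl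
      _ ≤ _ := by
        rw [Finset.sum_const, smul_eq_mul]
        exact Nat.mul_le_mul_right _ h3
  have h5 : p ≤ D + ((μ.erase (a ^ b)).biUnion Z).card :=
    h1.trans ((Finset.card_union_le _ _).trans (Nat.add_le_add_right h2 _))
  have h6 : e * l * p ≤ e * l * D + (e - 1) * ((l + D + 1) * p) :=
    (Nat.mul_le_mul_left _ h5).trans (by rw [mul_add]; omega)
  have hl0 : 0 < l := Nat.mul_pos he (by omega)
  have h7 : e * l * D < p := by
    have h9 : 1 * (l + 1 + e * l * D) ≤ l * (l + 1 + e * l * D) := Nat.mul_le_mul_right _ hl0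
    have h10 : 1 * b ≤ e * b := Nat.mul_le_mul_right _ he
    omega
  obtain ⟨e', he'⟩ : ∃ e', e = e' + 1 := ⟨e - 1, by omega⟩
  have h8 : e * l * p = (e - 1) * ((l + D + 1) * p) + (D + 1) * p := by
    simp only [l]
    rw [he']
    simp only [Nat.add_sub_cancel]
    ring
  have h9 : 1 * p ≤ (D + 1) * p := Nat.mul_le_mul_right _ (by omega)
  omega

end Stepanov

section LocalSolubility

theorem exists_bound_separable_map (f : ℤ[X]) (hsf : Squarefree (f.map (Int.castRingHom ℚ)))
    (hd : 0 < f.natDegree) :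
    ∃ N : ℕ, ∀ p : ℕ, p.Prime → N < p → (f.map (Int.castRingHom (ZMod p))).Separable ∧
      (f.map (Int.castRingHom (ZMod p))).natDegree = f.natDegree := by
  obtain ⟨a, b, hab⟩ := PerfectField.separable_iff_squarefree.2 hsf
  obtain ⟨s, hs, hs'⟩ := IsLocalization.integerNormalization_spec (nonZeroDivisors ℤ) a
  obtain ⟨t, ht, ht'⟩ := IsLocalization.integerNormalization_spec (nonZeroDivisors ℤ) b
  set a' := IsLocalization.integerNormalization (nonZeroDivisors ℤ) a
  set b' := IsLocalization.integerNormalization (nonZeroDivisors ℤ) b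
  have hs0 : s ≠ 0 := nonZeroDivisors.ne_zero hs
  have ht0 : t ≠ 0 := nonZeroDivisors.ne_zero ht
  have key : C t * a' * f + C s * b' * derivative f = C (s * t) := by
    refine map_injective (Int.castRingHom ℚ) Int.cast_injective ?_
    change a'.map (Int.castRingHom ℚ) = s • a at hs'
    change b'.map (Int.castRingHom ℚ) = t • b at ht'
    rw [derivative_map] at hab
    simp only [Polynomial.map_add, Polynomial.map_mul, map_C, hs', ht']
    simp only [zsmul_eq_mul, ← map_intCast (C : ℚ →+* ℚ[X]), eq_intCast, Int.cast_mul, C_mul]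
    linear_combination (C (s : ℚ) * C (t : ℚ)) * hab
  refine ⟨(s * t).natAbs + f.leadingCoeff.natAbs, fun p hp hNp => ?_⟩
  have := Fact.mk hp
  have hne : ∀ z : ℤ, z ≠ 0 → z.natAbs < p → ((z : ℤ) : ZMod p) ≠ 0 := by
    intro z hz hzp h
    rw [ZMod.intCast_zmod_eq_zero_iff_dvd, Int.natCast_dvd] at h
    exact absurd (Nat.le_of_dvd (Int.natAbs_pos.2 hz) h) (by omega)
  constructor
  · have h1 := congrArg (Polynomial.map (Int.castRingHom (ZMod p))) key
    simp only [Polynomial.map_add, Polynomial.map_mul, map_C, ← derivative_map] at h1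
    have hu := hne (s * t) (mul_ne_zero hs0 ht0) (by omega)
    rw [eq_intCast, eq_intCast, eq_intCast] at h1
    refine ⟨C (((s * t : ℤ) : ZMod p)⁻¹) * (C (t : ZMod p) * a'.map (Int.castRingHom (ZMod p))),
      C (((s * t : ℤ) : ZMod p)⁻¹) * (C (s : ZMod p) * b'.map (Int.castRingHom (ZMod p))), ?_⟩
    have h2 : C (((s * t : ℤ) : ZMod p)⁻¹) * C ((s * t : ℤ) : ZMod p) = 1 := by
      rw [← C_mul, inv_mul_cancel₀ hu, C_1]
    linear_combination C (((s * t : ℤ) : ZMod p)⁻¹) * h1 + h2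
  · refine natDegree_map_of_leadingCoeff_ne_zero _ (hne _ ?_ (by omega))
    rw [Ne, leadingCoeff_eq_zero]
    rintro rfl
    simp at hd

theorem exists_padicInt_root (p : ℕ) [Fact p.Prime] (F : ℤ[X]) (a : ℤ)
    (h : ‖((F.eval a : ℤ) : ℤ_[p])‖ < ‖((F.derivative.eval a : ℤ) : ℤ_[p])‖ ^ 2) :
    ∃ z : ℤ_[p], aeval z F = 0 := by
  have hcast (G : ℤ[X]) : aeval (a : ℤ_[p]) G = ((G.eval a : ℤ) : ℤ_[p]) := by
    rw [← eq_intCast (algebraMap ℤ ℤ_[p]) a, aeval_algebraMap_apply_eq_algebraMap_eval]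
    rfl
  obtain ⟨z, hz, -⟩ := hensels_lemma (p := p) (F := F) (a := a) (by rwa [hcast, hcast])
  exact ⟨z, hz⟩

theorem exists_padicInt_root_of_simple_root (p : ℕ) [Fact p.Prime] (F : ℤ[X]) (a : ℤ)
    (h0 : ((F.eval a : ℤ) : ZMod p) = 0) (h1 : ((F.derivative.eval a : ℤ) : ZMod p) ≠ 0) :
    ∃ z : ℤ_[p], aeval z F = 0 := by
  refine exists_padicInt_root p F a ?_
  rw [ZMod.intCast_zmod_eq_zero_iff_dvd] at h0
  rw [Ne, ZMod.intCast_zmod_eq_zero_iff_dvd, ← PadicInt.norm_intCast_lt_one_iff] at h1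
  have h2 : ‖((F.derivative.eval a : ℤ) : ℤ_[p])‖ = 1 :=
    le_antisymm (PadicInt.norm_le_one _) (not_lt.1 h1)
  rw [h2, one_pow]
  exact PadicInt.norm_intCast_lt_one_iff.2 h0

theorem hasTwistPoint_padic_of_padicInt {n : ℕ} {f : ℤ[X]} {d : ℤ} {p : ℕ} [Fact p.Prime]
    (x y : ℤ_[p]) (h : (d : ℤ_[p]) * y ^ n = aeval x f) : HasTwistPoint n f d ℚ_[p] := by
  refine ⟨x, y, ?_⟩
  have := congrArg (algebraMap ℤ_[p] ℚ_[p]) h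
  rw [← aeval_algebraMap_apply] at this
  simpa using this

theorem hasTwistPoint_padic_of_root {n : ℕ} (hn : n ≠ 0) {f : ℤ[X]} (d : ℤ) {p : ℕ}
    [Fact p.Prime] (hf : (f.map (Int.castRingHom (ZMod p))).Separable)
    (h : ∃ x : ZMod p, aeval x f = 0) : HasTwistPoint n f d ℚ_[p] := by
  obtain ⟨x, hx⟩ := h
  obtain ⟨a, rfl⟩ := ZMod.intCast_surjective x
  have hcast (G : ℤ[X]) : aeval (a : ZMod p) G = ((G.eval a : ℤ) : ZMod p) := by
    rw [← eq_intCast (algebraMap ℤ (ZMod p)) a, aeval_algebraMap_apply_eq_algebraMap_eval]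
    rfl
  rw [hcast] at hx
  obtain ⟨z, hz⟩ := exists_padicInt_root_of_simple_root p f a hx (by
    have h1 := hf.eval₂_derivative_ne_zero (RingHom.id _) (x := (a : ZMod p)) (by
      rw [eval₂_map, RingHom.id_comp]
      exact (hcast f).trans hx)
    rw [derivative_map, eval₂_map, RingHom.id_comp] at h1
    rw [← hcast]
    exact h1)
  exact hasTwistPoint_padic_of_padicInt z 0 (by rw [hz, zero_pow hn, mul_zero])

theorem hasTwistPoint_padic_of_not_dvd {n : ℕ} (hn : 0 < n) {f : ℤ[X]} {d : ℤ} {p : ℕ}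
    [Fact p.Prime] (hf : (f.map (Int.castRingHom (ZMod p))).Separable)
    (hd : (f.map (Int.castRingHom (ZMod p))).natDegree = f.natDegree) (hd0 : 0 < f.natDegree)
    (hp : (n * (f.natDegree + 1) + n + 1) ^ 5 < p) (hdp : ¬ (p : ℤ) ∣ d) :
    HasTwistPoint n f d ℚ_[p] := by
  have hdp' : (d : ZMod p) ≠ 0 := by rwa [Ne, ZMod.intCast_zmod_eq_zero_iff_dvd]
  obtain ⟨x, y, hy, hxy⟩ := exists_eval_eq_mul_pow p hn hp _ hd.le (hd ▸ hd0) hf hdp'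
  obtain ⟨a, rfl⟩ := ZMod.intCast_surjective x
  obtain ⟨b, rfl⟩ := ZMod.intCast_surjective y
  rw [eval_intCast_map] at hxy
  obtain ⟨z, hz⟩ := exists_padicInt_root_of_simple_root p (C d * X ^ n - C (f.eval a)) b (by
    simp only [eval_sub, eval_mul, eval_C, eval_pow, eval_X, Int.cast_sub, Int.cast_mul,
      Int.cast_pow]
    rw [hxy]
    simp) (by
    have hnp : (n : ZMod p) ≠ 0 := by
      rw [Ne, ZMod.natCast_eq_zero_iff]
      intro h
      have h1 := Nat.le_of_dvd hn h
      have h2 : n * (f.natDegree + 1) + n + 1 ≤ (n * (f.natDegree + 1) + n + 1) ^ 5 :=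
        Nat.le_self_pow (by norm_num) _
      omega
    simp [derivative_X_pow, hdp', hnp, hy])
  refine hasTwistPoint_padic_of_padicInt (a : ℤ_[p]) z ?_
  have h1 : aeval (a : ℤ_[p]) f = ((f.eval a : ℤ) : ℤ_[p]) := by
    rw [← eq_intCast (algebraMap ℤ ℤ_[p]) a, aeval_algebraMap_apply_eq_algebraMap_eval]
    rfl
  rw [h1]
  simpa [sub_eq_zero] using hz

theorem hasTwistPoint_padic_of_modEq {n : ℕ} (hn : 0 < n) {f : ℤ[X]} {d Q : ℤ} {p : ℕ}
    [Fact p.Prime] (hQ : (p : ℤ) ∣ Q) (hd : Q * n ^ 2 ∣ d - 1)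
    (h : HasTwistPoint n f 1 ℚ_[p]) : HasTwistPoint n f d ℚ_[p] := by
  obtain ⟨t, ht⟩ := hd
  obtain ⟨z, hz⟩ := exists_padicInt_root p (X ^ n - C d) 1 (by
    have h1 : (X ^ n - C d : ℤ[X]).eval 1 = -(Q * n ^ 2 * t) := by
      simp only [eval_sub, eval_pow, eval_X, eval_C, one_pow]
      omega
    have h2 : (derivative (X ^ n - C d : ℤ[X])).eval 1 = n := by simp [derivative_X_pow]
    have hn0 : 0 < ‖((n : ℤ) : ℤ_[p])‖ := by
      rw [norm_pos_iff]
      exact_mod_cast hn.ne'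
    have hQ1 := PadicInt.norm_intCast_lt_one_iff.2 hQ
    have ht1 := PadicInt.norm_le_one (t : ℤ_[p])
    rw [h1, h2, Int.cast_neg, norm_neg, Int.cast_mul, Int.cast_mul, Int.cast_pow, norm_mul,
      norm_mul, norm_pow]
    have h3 : 0 < ‖((n : ℤ) : ℤ_[p])‖ ^ 2 := by positivity
    have h4 : ‖(Q : ℤ_[p])‖ * ‖((n : ℤ) : ℤ_[p])‖ ^ 2 * ‖(t : ℤ_[p])‖ ≤
        ‖(Q : ℤ_[p])‖ * ‖((n : ℤ) : ℤ_[p])‖ ^ 2 := mul_le_of_le_one_right (by positivity) ht1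
    nlinarith)
  obtain ⟨x, y, hxy⟩ := h
  have hz' : (z : ℚ_[p]) ^ n = d := by
    have h1 : z ^ n = (d : ℤ_[p]) := by simpa [sub_eq_zero] using hz
    have := congrArg (fun u : ℤ_[p] => (u : ℚ_[p])) h1
    simpa using this
  by_cases hz0 : (z : ℚ_[p]) = 0
  · exfalso
    rw [hz0, zero_pow hn.ne'] at hz'
    have h0 : d = 0 := by exact_mod_cast hz'.symm
    have hp1 : (p : ℤ) ∣ 1 := by
      have h1 : (p : ℤ) ∣ Q * n ^ 2 * t := (hQ.mul_right _).mul_right _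
      rw [← ht, h0] at h1
      simpa using h1
    exact (Nat.Prime.one_lt Fact.out).ne'
      (by exact_mod_cast Int.eq_one_of_dvd_one (by positivity) hp1)
  · refine ⟨x, y / z, ?_⟩
    rw [← hxy, div_pow, hz', Int.cast_one, one_mul, mul_div_cancel₀]
    rw [← hz']
    exact pow_ne_zero _ hz0

theorem hasTwistPoint_real_of_pos {n : ℕ} (hn : 0 < n) {f : ℤ[X]} {d : ℤ} (hd : 0 < d)
    (h : HasTwistPoint n f 1 ℝ) : HasTwistPoint n f d ℝ := by
  obtain ⟨x, y, hxy⟩ := h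
  have hd' : (0 : ℝ) < d := by exact_mod_cast hd
  refine ⟨x, y / (d : ℝ) ^ (1 / n : ℝ), ?_⟩
  have h1 : ((d : ℝ) ^ (1 / n : ℝ)) ^ n = d := by
    rw [one_div, Real.rpow_inv_natCast_pow hd'.le hn.ne']
  rw [← hxy, div_pow, h1, Int.cast_one, one_mul, mul_div_cancel₀ _ hd'.ne']

/-- A positive integer `d ≡ 1` modulo a suitable `M`, all of whose prime factors `p` are such that
`f` has a root modulo `p`, gives an everywhere locally soluble twist. -/
theorem exists_modulus_everywhereLocallySoluble (n : ℕ) (hn : 0 < n) (f : ℤ[X])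
    (hsf : Squarefree (f.map (Int.castRingHom ℚ))) (hdeg : 0 < f.natDegree)
    (hls : EverywhereLocallySoluble n f 1) :
    ∃ M : ℕ, 0 < M ∧ ∀ d : ℤ, 0 < d → (M : ℤ) ∣ d - 1 →
      (∀ p : ℕ, p.Prime → (p : ℤ) ∣ d → ∃ x : ZMod p, aeval x f = 0) →
      EverywhereLocallySoluble n f d := by
  obtain ⟨N, hN⟩ := exists_bound_separable_map f hsf hdeg
  set N' := N + (n * (f.natDegree + 1) + n + 1) ^ 5 with hN'
  refine ⟨N'.factorial * n ^ 2, by positivity, fun d hd hdM hroot => ⟨?_, fun p hp => ?_⟩⟩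
  · exact hasTwistPoint_real_of_pos hn hd hls.1
  · have hpp : p.Prime := hp.out
    push_cast at hdM
    by_cases hpN : p ≤ N'
    · exact hasTwistPoint_padic_of_modEq hn (Q := N'.factorial)
        (by exact_mod_cast (Nat.dvd_factorial hpp.pos hpN)) hdM (hls.2 p hp)
    · obtain ⟨h1, h2⟩ := hN p hpp (by omega)
      by_cases hpd : (p : ℤ) ∣ d
      · exact hasTwistPoint_padic_of_root hn.ne' d h1 (hroot p hpp hpd)
      · exact hasTwistPoint_padic_of_not_dvd hn h1 h2 hdeg (by omega) hpd

end LocalSolubility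

section LatticePoints

open Finset

variable {S ι : Type*} [CommRing S] [Fintype ι] (b : Module.Basis ι ℤ S)

theorem exists_forall_abs_repr_mul_le :
    ∃ C : ℕ, ∀ (x y : S) (s t : ℕ), (∀ i, |b.repr x i| ≤ s) → (∀ i, |b.repr y i| ≤ t) →
      ∀ i, |b.repr (x * y) i| ≤ C * s * t := by
  refine ⟨∑ i, ∑ j, ∑ k, (b.repr (b j * b k) i).natAbs, fun x y s t hx hy i => ?_⟩
  have h1 : b.repr (x * y) i = ∑ j, ∑ k, b.repr x j * b.repr y k * b.repr (b j * b k) i := by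
    conv_lhs => rw [← b.sum_repr x, ← b.sum_repr y, sum_mul_sum]
    simp only [map_sum, Finsupp.finsetSum_apply, smul_mul_smul_comm, map_smul, Finsupp.smul_apply,
      smul_eq_mul]
  rw [h1]
  push_cast
  calc |∑ j, ∑ k, b.repr x j * b.repr y k * b.repr (b j * b k) i|
      ≤ ∑ j, ∑ k, |b.repr x j * b.repr y k * b.repr (b j * b k) i| :=
        (abs_sum_le_sum_abs _ _).trans (sum_le_sum fun j _ => abs_sum_le_sum_abs _ _)
    _ ≤ ∑ j, ∑ k, |b.repr (b j * b k) i| * s * t := by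
        refine sum_le_sum fun j _ => sum_le_sum fun k _ => ?_
        rw [abs_mul, abs_mul, mul_comm, mul_assoc]
        have := hx j
        have := hy k
        gcongr
    _ = (∑ j, ∑ k, |b.repr (b j * b k) i|) * s * t := by simp only [sum_mul]
    _ ≤ _ := by
        gcongr ?_ * _ * _
        exact single_le_sum (f := fun i => ∑ j, ∑ k, |b.repr (b j * b k) i|)
          (fun i _ => sum_nonneg fun j _ => sum_nonneg fun k _ => abs_nonneg _) (mem_univ i)

/-- The points of `S` whose coordinates lie in a given cube of side `H`. -/
noncomputable def coordBox (c : ι → ℤ) (H : ℕ) : Finset S := by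
  classical
  exact (Fintype.piFinset fun i => Ico (c i) (c i + H)).map b.equivFun.symm.toEquiv.toEmbedding

variable {b}

theorem mem_coordBox {c : ι → ℤ} {H : ℕ} {x : S} :
    x ∈ coordBox b c H ↔ ∀ i, c i ≤ b.repr x i ∧ b.repr x i < c i + H := by
  classical
  simp only [coordBox, mem_map_equiv, Fintype.mem_piFinset, mem_Ico]
  rfl

theorem card_coordBox (c : ι → ℤ) (H : ℕ) : #(coordBox b c H) = H ^ Fintype.card ι := by
  classical
  simp [coordBox, Fintype.card_piFinset]

variable [IsDedekindDomain S] [Module.Free ℤ S]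

theorem exists_mem_abs_repr_le (I : Ideal S) (hI : Ideal.absNorm I ≠ 0) (s : ℕ)
    (hs : Ideal.absNorm I < (s + 1) ^ Fintype.card ι) :
    ∃ α ∈ I, α ≠ 0 ∧ ∀ i, |b.repr α i| ≤ s := by
  classical
  rw [Ideal.absNorm_apply, Submodule.cardQuot_apply] at hI hs
  have : Finite (S ⧸ I) := Nat.finite_of_card_ne_zero hI
  have : Fintype (S ⧸ I) := Fintype.ofFinite _
  rw [Nat.card_eq_fintype_card, ← card_univ] at hs
  obtain ⟨x, hx, y, hy, hxy, h⟩ := exists_ne_map_eq_of_card_lt_of_maps_to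
    (s := coordBox b 0 (s + 1)) (t := univ) (by rwa [card_coordBox])
    (f := Ideal.Quotient.mk I) (fun _ _ => mem_coe.2 (mem_univ _))
  rw [mem_coordBox] at hx hy
  refine ⟨x - y, Ideal.Quotient.eq.1 h, sub_ne_zero.2 hxy, fun i => ?_⟩
  have h1 := hx i
  have h2 := hy i
  simp only [Pi.zero_apply, map_sub, Finsupp.sub_apply] at *
  push_cast at *
  rw [abs_le]
  omega

theorem exists_sub_mem_span_abs_repr_le {C : ℕ} (hC : ∀ (x y : S) (s t : ℕ),
      (∀ i, |b.repr x i| ≤ s) → (∀ i, |b.repr y i| ≤ t) → ∀ i, |b.repr (x * y) i| ≤ C * s * t)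
    [Module.Finite ℤ S] [CharZero S] {α : S} (hα : α ≠ 0) {s : ℕ}
    (hs : ∀ i, |b.repr α i| ≤ s) (y : S) :
    ∃ z, z - y ∈ Ideal.span {α} ∧ ∀ i, |b.repr z i| ≤ C * s := by
  set N := Ideal.absNorm (Ideal.span {α}) with hN
  have hN0 : 0 < N := by
    rw [Nat.pos_iff_ne_zero, hN, Ne, Ideal.absNorm_eq_zero_iff, Ideal.span_singleton_eq_bot]
    exact hα
  obtain ⟨β, hβ⟩ := Ideal.mem_span_singleton'.1 (Ideal.absNorm_mem (Ideal.span {α}))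
  rw [← hN] at hβ
  set u := b.equivFun.symm fun i => b.repr (y * β) i / N with hu
  set r := b.equivFun.symm fun i => b.repr (y * β) i % N with hr
  have hur : y * β = N * u + r := by
    apply b.repr.injective
    ext i
    have h1 : (N : S) * u = (N : ℤ) • u := by simp
    have h2 : b.repr u i = b.repr (y * β) i / N := by
      rw [hu, ← b.equivFun_apply, LinearEquiv.apply_symm_apply]
    have h3 : b.repr r i = b.repr (y * β) i % N := by
      rw [hr, ← b.equivFun_apply, LinearEquiv.apply_symm_apply]
    rw [h1, map_add, map_smul, Finsupp.add_apply, Finsupp.smul_apply, h2, h3, smul_eq_mul,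
      Int.mul_ediv_add_emod]
  refine ⟨y - α * u, ?_, fun i => ?_⟩
  · rw [sub_sub_cancel_left, neg_mem_iff]
    exact Ideal.mul_mem_right _ _ (Ideal.mem_span_singleton_self α)
  · have h1 : (N : ℤ) • (y - α * u) = α * r := by
      rw [zsmul_eq_mul, Int.cast_natCast]
      linear_combination α * hur - y * hβ
    have h2 := hC α r s N hs (fun i => by
      rw [hr, ← b.equivFun_apply, LinearEquiv.apply_symm_apply, abs_of_nonneg]
      · exact (Int.emod_lt_of_pos _ (by exact_mod_cast hN0)).le
      · exact Int.emod_nonneg _ (by exact_mod_cast hN0.ne')) i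
    rw [← h1, map_smul, Finsupp.smul_apply, smul_eq_mul, abs_mul, Nat.abs_cast, mul_comm] at h2
    exact le_of_mul_le_mul_right h2 (by exact_mod_cast hN0)

open scoped Classical in
theorem card_coordBox_filter_mem_ideal {I : Ideal S} (hI : Ideal.absNorm I ≠ 0) {ρ : ℕ}
    (hρ : ∀ y : S, ∃ z, z - y ∈ I ∧ ∀ i, |b.repr z i| ≤ ρ) (c : ι → ℤ) (H : ℕ) :
    (H - 2 * ρ) ^ Fintype.card ι ≤ Ideal.absNorm I * #{x ∈ coordBox b c H | x ∈ I} ∧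
      Ideal.absNorm I * #{x ∈ coordBox b c H | x ∈ I} ≤ (H + 2 * ρ) ^ Fintype.card ι := by
  have hcard : Ideal.absNorm I = Nat.card (S ⧸ I) := by
    rw [Ideal.absNorm_apply, Submodule.cardQuot_apply]
  have : Finite (S ⧸ I) := Nat.finite_of_card_ne_zero (hcard ▸ hI)
  have : Fintype (S ⧸ I) := Fintype.ofFinite _
  rw [hcard, Nat.card_eq_fintype_card, ← card_univ (α := S ⧸ I), ← card_product]
  have hrep : ∀ t : S ⧸ I, ∃ z : S, Ideal.Quotient.mk I z = t ∧ ∀ i, |b.repr z i| ≤ ρ := by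
    intro t
    obtain ⟨y, rfl⟩ := Ideal.Quotient.mk_surjective t
    obtain ⟨z, hz, hz'⟩ := hρ y
    exact ⟨z, Ideal.Quotient.eq.2 hz, hz'⟩
  choose rep hrep hrep' using hrep
  constructor
  · rw [← card_coordBox (b := b) (fun i => c i + ρ)]
    refine card_le_card_of_injOn
      (fun y => (Ideal.Quotient.mk I y, y - rep (Ideal.Quotient.mk I y))) (fun y hy => ?_)
      (fun y _ y' _ h => ?_)
    · rw [mem_coe, mem_coordBox] at hy
      simp only [coe_product, Set.mem_prod, mem_coe, mem_univ, true_and, mem_filter, mem_coordBox]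
      refine ⟨fun i => ?_, ?_⟩
      · have h1 := hy i
        have h2 := abs_le.1 (hrep' (Ideal.Quotient.mk I y) i)
        rw [map_sub, Finsupp.sub_apply]
        omega
      · rw [← Ideal.Quotient.eq, hrep]
    · simp only [Prod.mk.injEq] at h
      rw [h.1] at h
      exact sub_left_injective h.2
  · rw [← card_coordBox (b := b) (fun i => c i - ρ)]
    refine card_le_card_of_injOn (fun x => rep x.1 + x.2) (fun x hx => ?_) (fun x hx x' hx' h => ?_)
    · simp only [coe_product, Set.mem_prod, mem_coe, mem_univ, true_and, mem_filter,
        mem_coordBox] at hx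
      rw [mem_coe, mem_coordBox]
      intro i
      have h1 := hx.1 i
      have h2 := abs_le.1 (hrep' x.1 i)
      rw [map_add, Finsupp.add_apply]
      push_cast
      omega
    · simp only [coe_product, Set.mem_prod, mem_coe, mem_univ, true_and, mem_filter] at hx hx'
      have h1 := congrArg (Ideal.Quotient.mk I) h
      simp only [map_add, hrep, Ideal.Quotient.eq_zero_iff_mem.2 hx.2,
        Ideal.Quotient.eq_zero_iff_mem.2 hx'.2, add_zero] at h1
      refine Prod.ext h1 ?_
      simpa [h1] using h

end LatticePoints

section LatticeAsymptotics

open Finset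

open scoped Classical in
theorem exists_abs_card_coordBox_filter_sub_le {S ι : Type*} [CommRing S] [Fintype ι] [Nonempty ι]
    (b : Module.Basis ι ℤ S) [IsDedekindDomain S] [Module.Free ℤ S] [Module.Finite ℤ S]
    [CharZero S] (K : ℕ) :
    ∃ C : ℝ, 0 ≤ C ∧ ∀ (c : ι → ℤ) (H : ℕ) (I : Ideal S), Ideal.absNorm I ≠ 0 →
      Ideal.absNorm I ≤ (K * H) ^ Fintype.card ι →
      |(#{x ∈ coordBox b c H | x ∈ I} : ℝ) - H ^ Fintype.card ι / Ideal.absNorm I| ≤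
        C * H ^ (Fintype.card ι - 1) * (Ideal.absNorm I : ℝ) ^ ((1 / Fintype.card ι : ℝ) - 1) := by
  obtain ⟨C₀, hC₀⟩ := exists_forall_abs_repr_mul_le b
  set d := Fintype.card ι with hd
  have hd0 : d ≠ 0 := Fintype.card_ne_zero
  refine ⟨2 * C₀ * d * (1 + 2 * C₀ * K) ^ (d - 1), by positivity, fun c H I hI hIH => ?_⟩
  set q := Ideal.absNorm I with hq
  set t : ℝ := (q : ℝ) ^ (1 / d : ℝ) with ht
  have ht0 : 0 ≤ t := by positivity
  have htd : t ^ d = q := by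
    rw [ht, one_div, Real.rpow_inv_natCast_pow (by positivity) hd0]
  set s := ⌊t⌋₊ with hs
  have hst : (s : ℝ) ≤ t := Nat.floor_le ht0
  have hqs : q < (s + 1) ^ d := by
    have : (q : ℝ) < (s + 1) ^ d := by
      rw [← htd]
      exact pow_lt_pow_left₀ (Nat.lt_floor_add_one t) ht0 hd0
    exact_mod_cast this
  obtain ⟨α, hαI, hα0, hα⟩ := exists_mem_abs_repr_le (b := b) I hI s hqs
  obtain ⟨h1, h2⟩ := card_coordBox_filter_mem_ideal (b := b) hI (ρ := C₀ * s) (fun y => by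
    obtain ⟨z, hz, hz'⟩ := exists_sub_mem_span_abs_repr_le hC₀ hα0 hα y
    exact ⟨z, (Ideal.span_singleton_le_iff_mem I).2 hαI hz, by exact_mod_cast hz'⟩) c H
  set m := #{x ∈ coordBox b c H | x ∈ I}
  have htH : t ≤ K * H := by
    refine le_of_pow_le_pow_left₀ hd0 (by positivity) ?_
    rw [htd]
    exact_mod_cast hIH
  have hq0 : (0 : ℝ) < q := by positivity
  have h1' : (((H - 2 * (C₀ * s) : ℕ) : ℝ)) ^ d ≤ q * m := by exact_mod_cast h1
  have h2' : (q * m : ℝ) ≤ ((H : ℝ) + 2 * (C₀ * s)) ^ d := by exact_mod_cast h2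
  have hpow : ∀ u : ℝ, 0 ≤ u → |u - H| ≤ 2 * (C₀ * s) →
      |u ^ d - (H : ℝ) ^ d| ≤ 2 * C₀ * d * (1 + 2 * C₀ * K) ^ (d - 1) * H ^ (d - 1) * t := by
    intro u hu0 hu
    have h5 : u ≤ (1 + 2 * C₀ * K) * H := by
      have h6 : 2 * (C₀ * s : ℝ) ≤ 2 * (C₀ * (K * H)) := by gcongr; linarith
      have := le_abs_self (u - H)
      linarith
    have h7 : (H : ℝ) ≤ (1 + 2 * C₀ * K) * H := by
      have : (0 : ℝ) ≤ 2 * C₀ * K * H := by positivity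
      linarith
    calc |u ^ d - (H : ℝ) ^ d| ≤ |u - H| * d * max |u| |(H : ℝ)| ^ (d - 1) :=
          abs_pow_sub_pow_le _ _ _
      _ ≤ 2 * (C₀ * t) * d * ((1 + 2 * C₀ * K) * H) ^ (d - 1) := by
          rw [abs_of_nonneg hu0, Nat.abs_cast]
          have : |u - H| ≤ 2 * (C₀ * t) := hu.trans (by gcongr)
          gcongr
          exact max_le h5 h7
      _ = _ := by rw [mul_pow]; ring
  have hkey : |(q : ℝ) * m - (H : ℝ) ^ d| ≤
      2 * C₀ * d * (1 + 2 * C₀ * K) ^ (d - 1) * H ^ (d - 1) * t := by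
    rw [abs_le]
    constructor
    · have h3 := (abs_le.1 (hpow (H - 2 * (C₀ * s) : ℕ) (by positivity) (by
        rw [abs_sub_comm, abs_of_nonneg (sub_nonneg.2 (by exact_mod_cast Nat.sub_le _ _)),
          sub_le_iff_le_add]
        have : H ≤ 2 * (C₀ * s) + (H - 2 * (C₀ * s)) := by omega
        exact_mod_cast this))).1
      linarith
    · have h3 := (abs_le.1 (hpow (H + 2 * (C₀ * s)) (by positivity) (by
        rw [add_sub_cancel_left, abs_of_nonneg (by positivity)]))).2
      linarith
  have h8 : (m : ℝ) - H ^ d / q = (q * m - H ^ d) / q := by field_simp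
  rw [h8, abs_div, abs_of_pos hq0, div_le_iff₀ hq0, Real.rpow_sub_one hq0.ne', ← ht]
  refine hkey.trans (le_of_eq ?_)
  field_simp

open NumberField in
theorem exists_coordBox_norm_bounds {K ι : Type*} [Field K] [NumberField K] [Fintype ι]
    (b : Module.Basis ι ℤ (𝓞 K)) :
    ∃ A : ℕ, 0 < A ∧ ∀ H : ℕ, 0 < H → ∃ c : ι → ℤ, ∀ x ∈ coordBox b c H,
      H ^ Fintype.card ι ≤ Ideal.absNorm (Ideal.span {x}) ∧
        Ideal.absNorm (Ideal.span {x}) ≤ (A * H) ^ Fintype.card ι := by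
  obtain ⟨D, hD⟩ := exists_nat_ge (∑ σ : K →ₐ[ℚ] ℂ, ∑ i, ‖σ (b i : K)‖)
  refine ⟨2 * D + 1, by omega, fun H hH => ⟨fun i => ((D + 1) * H : ℕ) * b.repr 1 i, ?_⟩⟩
  intro x hx
  rw [mem_coordBox] at hx
  have hcard : Fintype.card (K →ₐ[ℚ] ℂ) = Fintype.card ι := by
    rw [AlgHom.card, ← RingOfIntegers.rank, Module.finrank_eq_card_basis b]
  have hnorm : (Ideal.absNorm (Ideal.span {x}) : ℝ) = ∏ σ : K →ₐ[ℚ] ℂ, ‖σ (x : K)‖ := by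
    rw [Ideal.absNorm_span_singleton, ← norm_prod, ← Algebra.norm_eq_prod_embeddings,
      ← Algebra.coe_norm_int, Nat.cast_natAbs]
    simp
  have hσ : ∀ σ : K →ₐ[ℚ] ℂ, (H : ℝ) ≤ ‖σ (x : K)‖ ∧ ‖σ (x : K)‖ ≤ ((2 * D + 1 : ℕ) : ℝ) * H := by
    intro σ
    set y : 𝓞 K := x - ((D + 1) * H : ℕ) with hy
    have hyi : ∀ i, |b.repr y i| ≤ H := by
      intro i
      have h1 : y = x - (((D + 1) * H : ℕ) : ℤ) • (1 : 𝓞 K) := by simp [hy]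
      rw [h1, map_sub, map_smul, Finsupp.sub_apply, Finsupp.smul_apply, smul_eq_mul, abs_le]
      have := hx i
      omega
    have h2 : σ (y : K) = ∑ i, (b.repr y i : ℂ) * σ (b i : K) := by
      conv_lhs => rw [← b.sum_repr y]
      simp
    have h3 : ‖σ (y : K)‖ ≤ H * D := by
      rw [h2]
      calc ‖∑ i, (b.repr y i : ℂ) * σ (b i : K)‖ ≤ ∑ i, ‖(b.repr y i : ℂ) * σ (b i : K)‖ :=
            norm_sum_le _ _
        _ ≤ ∑ i, H * ‖σ (b i : K)‖ := by
            refine sum_le_sum fun i _ => ?_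
            rw [norm_mul, Complex.norm_intCast]
            gcongr
            exact_mod_cast hyi i
        _ = H * ∑ i, ‖σ (b i : K)‖ := (mul_sum _ _ _).symm
        _ ≤ H * D := by
            gcongr
            refine le_trans ?_ hD
            exact single_le_sum (f := fun σ : K →ₐ[ℚ] ℂ => ∑ i, ‖σ (b i : K)‖)
              (fun _ _ => sum_nonneg fun _ _ => norm_nonneg _) (mem_univ σ)
    have h4 : σ (x : K) = ((D + 1) * H : ℕ) + σ (y : K) := by simp [hy]
    have h5 : ‖(((D + 1) * H : ℕ) : ℂ)‖ = (D + 1) * H := by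
      rw [Complex.norm_natCast]
      push_cast
      ring
    rw [h4]
    constructor
    · have := norm_sub_le_norm_add (((D + 1) * H : ℕ) : ℂ) (σ (y : K))
      linarith
    · have := norm_add_le (((D + 1) * H : ℕ) : ℂ) (σ (y : K))
      push_cast at *
      linarith
  rw [← hcard]
  constructor
  · have : (H : ℝ) ^ Fintype.card (K →ₐ[ℚ] ℂ) ≤ Ideal.absNorm (Ideal.span {x}) := by
      rw [hnorm, ← card_univ, ← prod_const]
      exact prod_le_prod (fun _ _ => by positivity) fun σ _ => (hσ σ).1
    exact_mod_cast this
  · have : (Ideal.absNorm (Ideal.span {x}) : ℝ) ≤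
        (((2 * D + 1 : ℕ) : ℝ) * H) ^ Fintype.card (K →ₐ[ℚ] ℂ) := by
      rw [hnorm, ← card_univ, ← prod_const]
      exact prod_le_prod (fun _ _ => by positivity) fun σ _ => (hσ σ).2
    exact_mod_cast this

end LatticeAsymptotics

section IdealVonMangoldt

open Finset UniqueFactorizationMonoid

variable {R : Type*} [CommRing R] [IsDedekindDomain R]

theorem pow_dvd_iff_le_count_normalizedFactors [DecidableEq (Ideal R)] {P J : Ideal R}
    (hP : Prime P) (hJ : J ≠ ⊥) {k : ℕ} : P ^ k ∣ J ↔ k ≤ (normalizedFactors J).count P := by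
  rw [pow_dvd_iff_le_emultiplicity, emultiplicity_eq_count_normalizedFactors hP.irreducible hJ,
    normalize_eq, Nat.cast_le]

variable [Module.Free ℤ R]

/-- The von Mangoldt function on ideals: `log N(P)` at the powers of a prime `P`. -/
noncomputable def idealVonMangoldt (Q : Ideal R) : ℝ :=
  open scoped Classical in if IsPrimePow Q then Real.log (Ideal.absNorm Q.radical) else 0

theorem idealVonMangoldt_pow {P : Ideal R} (hP : Prime P) {k : ℕ} (hk : k ≠ 0) :
    idealVonMangoldt (P ^ k) = Real.log (Ideal.absNorm P) := by
  have h : IsPrimePow (P ^ k) := ⟨P, k, hP, Nat.pos_of_ne_zero hk, rfl⟩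
  rw [idealVonMangoldt, if_pos h, Ideal.radical_pow _ hk, (Ideal.isPrime_of_prime hP).radical]

theorem idealVonMangoldt_nonneg (Q : Ideal R) : 0 ≤ idealVonMangoldt Q := by
  rw [idealVonMangoldt]
  split_ifs
  · exact Real.log_natCast_nonneg _
  · exact le_rfl

theorem log_absNorm_eq_sum_count [DecidableEq (Ideal R)] [Module.Finite ℤ R] [CharZero R]
    {J : Ideal R} (hJ : J ≠ ⊥) :
    Real.log (Ideal.absNorm J) = ∑ P ∈ (normalizedFactors J).toFinset,
      (normalizedFactors J).count P * Real.log (Ideal.absNorm P) := by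
  conv_lhs => rw [← Ideal.prod_normalizedFactors_eq_self hJ]
  rw [prod_multiset_count, map_prod, Nat.cast_prod, Real.log_prod]
  · refine sum_congr rfl fun P _ => ?_
    rw [map_pow, Nat.cast_pow, Real.log_pow]
  · intro P hP
    rw [map_pow, Nat.cast_pow]
    refine pow_ne_zero _ ?_
    rw [Nat.cast_ne_zero, Ne, Ideal.absNorm_eq_zero_iff]
    exact (prime_of_normalized_factor P (Multiset.mem_toFinset.1 hP)).ne_zero

theorem log_absNorm_eq_sum_idealVonMangoldt [Module.Finite ℤ R] [CharZero R] {J : Ideal R}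
    (hJ : J ≠ ⊥) (s : Finset (Ideal R)) (hs : ∀ Q, Q ∣ J → Q ∈ s) [DecidablePred (· ∣ J)] :
    Real.log (Ideal.absNorm J) = ∑ Q ∈ s with Q ∣ J, idealVonMangoldt Q := by
  classical
  set F := normalizedFactors J with hF
  have hprime : ∀ P ∈ F.toFinset, Prime P := fun P hP =>
    prime_of_normalized_factor P (Multiset.mem_toFinset.1 hP)
  set T : Finset ((_ : Ideal R) × ℕ) := F.toFinset.sigma fun P => Icc 1 (F.count P) with hT
  have hT' : ∀ x ∈ T, Prime x.1 ∧ x.2 ≠ 0 ∧ x.1 ^ x.2 ∣ J := by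
    intro x hx
    rw [hT, mem_sigma, mem_Icc] at hx
    refine ⟨hprime _ hx.1, by omega, ?_⟩
    rw [pow_dvd_iff_le_count_normalizedFactors (hprime _ hx.1) hJ]
    exact hx.2.2
  have hinj : Set.InjOn (fun x : (_ : Ideal R) × ℕ => x.1 ^ x.2) T := by
    rintro ⟨P, k⟩ hx ⟨P', k'⟩ hx' h
    obtain ⟨h1, h2, -⟩ := hT' _ hx
    obtain ⟨h1', h2', -⟩ := hT' _ hx'
    have h3 : P = P' := by
      have := congrArg Ideal.radical h
      simpa only [Ideal.radical_pow _ h2, Ideal.radical_pow _ h2',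
        (Ideal.isPrime_of_prime h1).radical, (Ideal.isPrime_of_prime h1').radical] using this
    subst h3
    have h4 := (Ideal.pow_right_strictAnti P h1.ne_zero
      (Ideal.isPrime_of_prime h1).ne_top).injective h
    exact Sigma.ext rfl (heq_of_eq h4)
  calc Real.log (Ideal.absNorm J) = ∑ x ∈ T, idealVonMangoldt (x.1 ^ x.2) := by
        rw [log_absNorm_eq_sum_count hJ, hT, sum_sigma]
        refine sum_congr rfl fun P hP => ?_
        rw [sum_congr rfl (g := fun _ => Real.log (Ideal.absNorm P)), sum_const, Nat.card_Icc,
          nsmul_eq_mul, Nat.add_sub_cancel]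
        intro k hk
        rw [mem_Icc] at hk
        exact idealVonMangoldt_pow (hprime P hP) (Nat.one_le_iff_ne_zero.1 hk.1)
    _ = ∑ Q ∈ T.image fun x => x.1 ^ x.2, idealVonMangoldt Q := (sum_image hinj).symm
    _ = ∑ Q ∈ s with Q ∣ J, idealVonMangoldt Q := by
        refine sum_subset (fun Q hQ => ?_) fun Q hQ hQ' => ?_
        · obtain ⟨x, hx, rfl⟩ := mem_image.1 hQ
          exact mem_filter.2 ⟨hs _ (hT' x hx).2.2, (hT' x hx).2.2⟩
        · rw [idealVonMangoldt, if_neg]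
          rintro ⟨P, k, hP, hk, rfl⟩
          refine hQ' (mem_image.2 ⟨⟨P, k⟩, ?_, rfl⟩)
          have hdvd := (mem_filter.1 hQ).2
          rw [pow_dvd_iff_le_count_normalizedFactors hP hJ] at hdvd
          rw [hT, mem_sigma, mem_Icc, Multiset.mem_toFinset]
          exact ⟨Multiset.one_le_count_iff_mem.1 (hk.trans_le hdvd), hk, hdvd⟩

variable [Module.Finite ℤ R] [CharZero R]

variable (R) in
/-- The ideals of norm `q`. -/
noncomputable def idealsOfNorm (q : ℕ) : Finset (Ideal R) :=
  (Ideal.finite_setOfPred_absNorm_eq q).toFinset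

theorem mem_idealsOfNorm {q : ℕ} {Q : Ideal R} : Q ∈ idealsOfNorm R q ↔ Ideal.absNorm Q = q := by
  simp [idealsOfNorm]

variable (R) in
/-- The total mass of `idealVonMangoldt` on ideals of norm `q`. -/
noncomputable def normVonMangoldt (q : ℕ) : ℝ := ∑ Q ∈ idealsOfNorm R q, idealVonMangoldt Q

theorem normVonMangoldt_nonneg (q : ℕ) : 0 ≤ normVonMangoldt R q :=
  sum_nonneg fun Q _ => idealVonMangoldt_nonneg Q

theorem sum_log_absNorm_le (p : ℕ) (hp : p.Prime) (s : Finset (Ideal R))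
    (hs : ∀ P ∈ s, Prime P ∧ (p : R) ∈ P) :
    ∑ P ∈ s, Real.log (Ideal.absNorm P) ≤ Module.finrank ℤ R * Real.log p := by
  classical
  have hp0 : (p : R) ≠ 0 := by exact_mod_cast hp.ne_zero
  have hJ : Ideal.span {(p : R)} ≠ ⊥ := by rwa [Ne, Ideal.span_singleton_eq_bot]
  have h1 : Ideal.absNorm (Ideal.span {(p : R)}) = p ^ Module.finrank ℤ R := by
    rw [Ideal.absNorm_span_singleton, ← map_natCast (algebraMap ℤ R), Algebra.norm_algebraMap]
    simp [Int.natAbs_pow]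
  have h2 := log_absNorm_eq_sum_count hJ
  rw [h1, Nat.cast_pow, Real.log_pow] at h2
  rw [h2]
  have h3 : ∀ P ∈ s, 1 ≤ (normalizedFactors (Ideal.span {(p : R)})).count P := by
    intro P hP
    rw [← pow_dvd_iff_le_count_normalizedFactors (hs P hP).1 hJ, pow_one, Ideal.dvd_span_singleton]
    exact (hs P hP).2
  refine le_trans (sum_le_sum (g := fun P => (normalizedFactors (Ideal.span {(p : R)})).count P *
    Real.log (Ideal.absNorm P)) fun P hP => ?_) (sum_le_sum_of_subset_of_nonneg (fun P hP => ?_)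
    fun P _ _ => by have := Real.log_natCast_nonneg (Ideal.absNorm P); positivity)
  · refine le_mul_of_one_le_left (Real.log_natCast_nonneg _) ?_
    exact_mod_cast h3 P hP
  · rw [Multiset.mem_toFinset]
    exact Multiset.one_le_count_iff_mem.1 (h3 P hP)

theorem normVonMangoldt_le (q : ℕ) :
    normVonMangoldt R q ≤ Module.finrank ℤ R * ArithmeticFunction.vonMangoldt q := by
  classical
  set s := {Q ∈ idealsOfNorm R q | IsPrimePow Q} with hs
  have h0 : normVonMangoldt R q = ∑ Q ∈ s, Real.log (Ideal.absNorm Q.radical) := by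
    rw [normVonMangoldt, hs, sum_filter]
    exact sum_congr rfl fun Q _ => rfl
  rw [h0]
  rcases s.eq_empty_or_nonempty with hse | ⟨Q₀, hQ₀⟩
  · rw [hse, sum_empty]
    exact mul_nonneg (by positivity) ArithmeticFunction.vonMangoldt_nonneg
  have hrad : ∀ Q ∈ s, Prime Q.radical ∧ ∃ k, k ≠ 0 ∧ Q = Q.radical ^ k ∧
      Ideal.absNorm Q.radical ^ k = q := by
    intro Q hQ
    rw [hs, mem_filter, mem_idealsOfNorm] at hQ
    obtain ⟨hQq, P, k, hP, hk, rfl⟩ := hQ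
    rw [Ideal.radical_pow _ hk.ne', (Ideal.isPrime_of_prime hP).radical]
    exact ⟨hP, k, hk.ne', rfl, by rw [← map_pow, hQq]⟩
  obtain ⟨hP₀, k₀, hk₀, -, hq₀⟩ := hrad Q₀ hQ₀
  obtain ⟨p, m, hp, hm, hpm⟩ : ∃ p m : ℕ, p.Prime ∧ m ≠ 0 ∧ p ^ m = Ideal.absNorm Q₀.radical := by
    have hmax : Q₀.radical.IsMaximal := (Ideal.isPrime_of_prime hP₀).isMaximal hP₀.ne_zero
    let := Ideal.Quotient.field Q₀.radical
    have hne : Nat.card (R ⧸ Q₀.radical) ≠ 0 := by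
      rw [← Submodule.cardQuot_apply, ← Ideal.absNorm_apply, Ne, Ideal.absNorm_eq_zero_iff]
      exact hP₀.ne_zero
    have : Finite (R ⧸ Q₀.radical) := Nat.finite_of_card_ne_zero hne
    have : Fintype (R ⧸ Q₀.radical) := Fintype.ofFinite _
    obtain ⟨p, hchar⟩ := CharP.exists (R ⧸ Q₀.radical)
    obtain ⟨m, hp, hm⟩ := FiniteField.card (R ⧸ Q₀.radical) p
    refine ⟨p, m, hp, m.ne_zero, ?_⟩
    rw [Ideal.absNorm_apply, Submodule.cardQuot_apply, Nat.card_eq_fintype_card, hm]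
  have hqp : q = p ^ (m * k₀) := by rw [pow_mul, hpm, hq₀]
  have hmk : m * k₀ ≠ 0 := mul_ne_zero hm hk₀
  rw [show ArithmeticFunction.vonMangoldt q = Real.log p by
    rw [hqp, ArithmeticFunction.vonMangoldt_apply_pow hmk,
      ArithmeticFunction.vonMangoldt_apply_prime hp]]
  have hinj : Set.InjOn (Ideal.radical (R := R)) s := by
    intro Q hQ Q' hQ' h
    obtain ⟨h1, k, hk, h2, h3⟩ := hrad Q hQ
    obtain ⟨h1', k', hk', h2', h3'⟩ := hrad Q' hQ'
    rw [h] at h3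
    have h4 : Ideal.absNorm Q'.radical ≠ 0 := by
      rw [Ne, Ideal.absNorm_eq_zero_iff]
      exact h1'.ne_zero
    have h5 : Ideal.absNorm Q'.radical ≠ 1 := by
      rw [Ne, Ideal.absNorm_eq_one_iff]
      exact (Ideal.isPrime_of_prime h1').ne_top
    have h6 : k = k' := Nat.pow_right_injective (by omega) (h3.trans h3'.symm)
    calc Q = Q.radical ^ k := h2
      _ = Q'.radical ^ k' := by rw [h, h6]
      _ = Q' := h2'.symm
  rw [← sum_image (f := fun P : Ideal R => Real.log (Ideal.absNorm P)) hinj]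
  refine sum_log_absNorm_le p hp _ fun P hP => ?_
  obtain ⟨Q, hQ, rfl⟩ := mem_image.1 hP
  obtain ⟨h1, k, hk, h2, h3⟩ := hrad Q hQ
  refine ⟨h1, ?_⟩
  have h4 : ((p : R)) ^ (m * k₀) ∈ Q := by
    have := Ideal.absNorm_mem Q
    rw [mem_idealsOfNorm.1 (mem_filter.1 hQ).1, hqp] at this
    exact_mod_cast this
  exact ⟨_, h4⟩

end IdealVonMangoldt

section MertensNumberField

open Finset

theorem sum_vonMangoldt_mul_le_of_antitone {φ : ℕ → ℝ} (h0 : ∀ q, 1 ≤ q → 0 ≤ φ q)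
    (hφ : ∀ q, 1 ≤ q → φ (q + 1) ≤ φ q) (Y : ℕ) :
    ∑ q ∈ Icc 1 Y, ArithmeticFunction.vonMangoldt q * φ q ≤
      (Real.log 4 + 4) * ∑ q ∈ Icc 1 Y, φ q := by
  set c := Real.log 4 + 4
  have hψ : ∀ Y : ℕ, ∑ q ∈ Icc 1 Y, (ArithmeticFunction.vonMangoldt q - c) ≤ 0 := by
    intro Y
    have h1 := Chebyshev.psi_le_const_mul_self (x := Y) (by positivity)
    rw [Chebyshev.psi, Nat.floor_natCast, ← Icc_add_one_left_eq_Ioc, zero_add] at h1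
    rw [sum_sub_distrib, sum_const, Nat.card_Icc, nsmul_eq_mul, Nat.add_sub_cancel]
    linarith
  have key : ∀ Y : ℕ, 1 ≤ Y → ∑ q ∈ Icc 1 Y, (ArithmeticFunction.vonMangoldt q - c) * φ q ≤
      (∑ q ∈ Icc 1 Y, (ArithmeticFunction.vonMangoldt q - c)) * φ Y := by
    intro Y hY
    induction Y, hY using Nat.le_induction with
    | base => simp
    | succ Y hY ih =>
      rw [sum_Icc_succ_top (by omega), sum_Icc_succ_top (by omega), add_mul]
      have := mul_le_mul_of_nonpos_left (hφ Y hY) (hψ Y)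
      linarith
  rcases Nat.eq_zero_or_pos Y with rfl | hY
  · simp
  · have h1 := (key Y hY).trans (mul_nonpos_of_nonpos_of_nonneg (hψ Y) (h0 Y hY))
    simp only [sub_mul, sum_sub_distrib, ← mul_sum] at h1
    linarith

theorem sum_rpow_sub_one_le {a : ℝ} (ha : 0 < a) (ha1 : a ≤ 1) (Y : ℕ) :
    ∑ q ∈ Icc 1 Y, (q : ℝ) ^ (a - 1) ≤ (Y : ℝ) ^ a / a := by
  induction Y with
  | zero => simp [ha.ne']
  | succ Y ih =>
    rw [sum_Icc_succ_top (by omega)]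
    have hY : (0 : ℝ) < (Y + 1 : ℕ) := by positivity
    have h1 : (Y : ℝ) ^ a ≤ ((Y + 1 : ℕ) : ℝ) ^ a - a * ((Y + 1 : ℕ) : ℝ) ^ (a - 1) := by
      have h2 := rpow_one_add_le_one_add_mul_self (s := -1 / ((Y + 1 : ℕ) : ℝ)) (by
        rw [le_div_iff₀ hY]
        push_cast
        linarith [Nat.cast_nonneg (α := ℝ) Y]) ha.le ha1
      have h3 : 1 + -1 / ((Y + 1 : ℕ) : ℝ) = Y / ((Y + 1 : ℕ) : ℝ) := by
        push_cast
        field_simp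
        ring
      rw [h3, Real.div_rpow (by positivity) hY.le, div_le_iff₀ (by positivity)] at h2
      rw [Real.rpow_sub_one hY.ne']
      refine h2.trans (le_of_eq ?_)
      field_simp
      ring
    have h4 : (Y : ℝ) ^ a / a ≤ ((Y + 1 : ℕ) : ℝ) ^ a / a - ((Y + 1 : ℕ) : ℝ) ^ (a - 1) := by
      rw [div_le_iff₀ ha, sub_mul, div_mul_cancel₀ _ ha.ne']
      linarith
    linarith

open scoped Classical in
theorem log_absNorm_eq_sum_sum {R : Type*} [CommRing R] [IsDedekindDomain R] [Module.Free ℤ R]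
    [Module.Finite ℤ R] [CharZero R] {J : Ideal R} (hJ : J ≠ ⊥) {Y : ℕ}
    (hY : Ideal.absNorm J ≤ Y) :
    Real.log (Ideal.absNorm J) = ∑ q ∈ Icc 1 Y, ∑ Q ∈ idealsOfNorm R q,
      if Q ∣ J then idealVonMangoldt Q else 0 := by
  have hJ0 : Ideal.absNorm J ≠ 0 := by rwa [Ne, Ideal.absNorm_eq_zero_iff]
  rw [log_absNorm_eq_sum_idealVonMangoldt hJ ((Icc 1 Y).biUnion (idealsOfNorm R)), sum_filter,
    sum_biUnion]
  · intro q _ q' _ hqq'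
    simp only [Function.onFun, disjoint_left]
    intro Q hQ hQ'
    rw [mem_idealsOfNorm] at hQ hQ'
    exact hqq' (hQ.symm.trans hQ')
  · intro Q hQ
    have h1 : Ideal.absNorm Q ∣ Ideal.absNorm J := map_dvd _ hQ
    simp only [mem_biUnion, mem_Icc, mem_idealsOfNorm]
    exact ⟨_, ⟨Nat.pos_of_dvd_of_pos h1 (Nat.pos_of_ne_zero hJ0),
      (Nat.le_of_dvd (Nat.pos_of_ne_zero hJ0) h1).trans hY⟩, rfl⟩

open NumberField

variable (K : Type*) [Field K] [NumberField K]

theorem exists_abs_sum_normVonMangoldt_pow_sub_le :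
    ∃ A : ℕ, 0 < A ∧ ∃ C : ℝ, 0 ≤ C ∧ ∀ H : ℕ, 0 < H →
      |∑ q ∈ Icc 1 ((A * H) ^ Module.finrank ℚ K), normVonMangoldt (𝓞 K) q / q -
        Module.finrank ℚ K * Real.log H| ≤ C := by
  classical
  set b := RingOfIntegers.basis K
  have hcard : Fintype.card (Module.Free.ChooseBasisIndex ℤ (𝓞 K)) = Module.finrank ℚ K := by
    rw [← RingOfIntegers.rank, Module.finrank_eq_card_basis b]
  set d := Module.finrank ℚ K with hd
  have hd0 : 0 < d := Module.finrank_pos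
  obtain ⟨A, hA, hbox⟩ := exists_coordBox_norm_bounds b
  have : Nonempty (Module.Free.ChooseBasisIndex ℤ (𝓞 K)) :=
    Fintype.card_pos_iff.1 (hcard ▸ hd0)
  obtain ⟨C, hC, hcount⟩ := exists_abs_card_coordBox_filter_sub_le b A
  rw [hcard] at hbox hcount
  refine ⟨A, hA, C * (d * ((Real.log 4 + 4) * (A * d))) + d * Real.log A, ?_, fun H hH => ?_⟩
  · have := Real.log_natCast_nonneg A
    positivity
  obtain ⟨c, hc⟩ := hbox H hH
  set Y := (A * H) ^ d with hY
  set B := coordBox b c H with hB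
  have hH' : (0 : ℝ) < H := by exact_mod_cast hH
  have hA' : (0 : ℝ) < A := by exact_mod_cast hA
  have hBcard : (#B : ℝ) = (H : ℝ) ^ d := by
    rw [hB, card_coordBox, hcard, Nat.cast_pow]
  have hx0 : ∀ x ∈ B, Ideal.span {x} ≠ ⊥ := by
    intro x hx h
    have h1 := (hc x hx).1
    rw [h, Ideal.absNorm_bot] at h1
    exact absurd h1 (not_le.2 (by positivity))
  set L := ∑ x ∈ B, Real.log (Ideal.absNorm (Ideal.span {x})) with hL
  have hL1 : L = ∑ q ∈ Icc 1 Y, ∑ Q ∈ idealsOfNorm (𝓞 K) q,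
      idealVonMangoldt Q * #{x ∈ B | x ∈ Q} := by
    rw [hL, sum_congr rfl fun x hx => log_absNorm_eq_sum_sum (hx0 x hx) (hc x hx).2, sum_comm]
    refine sum_congr rfl fun q _ => ?_
    rw [sum_comm]
    refine sum_congr rfl fun Q _ => ?_
    simp only [Ideal.dvd_span_singleton]
    rw [← sum_filter, sum_const, nsmul_eq_mul, mul_comm]
  have hmain : |L - H ^ d * ∑ q ∈ Icc 1 Y, normVonMangoldt (𝓞 K) q / q| ≤
      C * (d * ((Real.log 4 + 4) * (A * d))) * H ^ d := by
    have h1 : L - H ^ d * ∑ q ∈ Icc 1 Y, normVonMangoldt (𝓞 K) q / q =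
        ∑ q ∈ Icc 1 Y, ∑ Q ∈ idealsOfNorm (𝓞 K) q,
          idealVonMangoldt Q * (#{x ∈ B | x ∈ Q} - H ^ d / Ideal.absNorm Q) := by
      rw [hL1, mul_sum, ← sum_sub_distrib]
      refine sum_congr rfl fun q _ => ?_
      rw [normVonMangoldt, sum_div, mul_sum, ← sum_sub_distrib]
      refine sum_congr rfl fun Q hQ => ?_
      rw [mem_idealsOfNorm.1 hQ]
      ring
    rw [h1]
    calc |∑ q ∈ Icc 1 Y, ∑ Q ∈ idealsOfNorm (𝓞 K) q,
          idealVonMangoldt Q * (#{x ∈ B | x ∈ Q} - H ^ d / Ideal.absNorm Q)|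
        ≤ ∑ q ∈ Icc 1 Y, ∑ Q ∈ idealsOfNorm (𝓞 K) q,
          |idealVonMangoldt Q * (#{x ∈ B | x ∈ Q} - H ^ d / Ideal.absNorm Q)| :=
          (abs_sum_le_sum_abs _ _).trans (sum_le_sum fun _ _ => abs_sum_le_sum_abs _ _)
      _ ≤ ∑ q ∈ Icc 1 Y, ∑ Q ∈ idealsOfNorm (𝓞 K) q,
          idealVonMangoldt Q * (C * H ^ (d - 1) * (q : ℝ) ^ ((1 / d : ℝ) - 1)) := by
          refine sum_le_sum fun q hq => sum_le_sum fun Q hQ => ?_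
          rw [mem_Icc] at hq
          rw [mem_idealsOfNorm] at hQ
          rw [abs_mul, abs_of_nonneg (idealVonMangoldt_nonneg Q)]
          refine mul_le_mul_of_nonneg_left ?_ (idealVonMangoldt_nonneg Q)
          have h2 := hcount c H Q (by omega) (by omega)
          rw [hQ] at h2 ⊢
          exact h2
      _ = C * H ^ (d - 1) *
          ∑ q ∈ Icc 1 Y, normVonMangoldt (𝓞 K) q * (q : ℝ) ^ ((1 / d : ℝ) - 1) := by
          rw [mul_sum]
          refine sum_congr rfl fun q _ => ?_
          rw [← sum_mul, ← normVonMangoldt]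
          ring
      _ ≤ C * H ^ (d - 1) * ∑ q ∈ Icc 1 Y,
          d * (ArithmeticFunction.vonMangoldt q * (q : ℝ) ^ ((1 / d : ℝ) - 1)) := by
          refine mul_le_mul_of_nonneg_left (sum_le_sum fun q _ => ?_) (by positivity)
          rw [← mul_assoc]
          refine mul_le_mul_of_nonneg_right ?_ (by positivity)
          rw [hd, ← RingOfIntegers.rank]
          exact normVonMangoldt_le q
      _ ≤ C * H ^ (d - 1) * (d * ((Real.log 4 + 4) * ((Y : ℝ) ^ (1 / d : ℝ) / (1 / d)))) := by
          have hd1 : (1 / d : ℝ) ≤ 1 := by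
            rw [div_le_one (by positivity)]
            exact_mod_cast hd0
          rw [← mul_sum]
          gcongr
          refine (sum_vonMangoldt_mul_le_of_antitone (fun q _ => by positivity)
            (fun q hq => ?_) Y).trans ?_
          · refine Real.rpow_le_rpow_of_nonpos (by exact_mod_cast hq) ?_ (by linarith)
            push_cast
            linarith
          · gcongr
            exact sum_rpow_sub_one_le (by positivity) hd1 Y
      _ = C * (d * ((Real.log 4 + 4) * (A * d))) * H ^ d := by
          have h3 : (Y : ℝ) ^ (1 / d : ℝ) = A * H := by
            rw [hY, one_div]
            push_cast
            rw [Real.pow_rpow_inv_natCast (by positivity) hd0.ne']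
          rw [h3, ← Nat.sub_add_cancel hd0, pow_succ, Nat.add_sub_cancel]
          field_simp
  have hlow : (H : ℝ) ^ d * (d * Real.log H) ≤ L := by
    rw [hL, ← hBcard, ← nsmul_eq_mul, ← Real.log_pow]
    refine card_nsmul_le_sum _ _ _ fun x hx => Real.log_le_log (by positivity) ?_
    exact_mod_cast (hc x hx).1
  have hup : L ≤ (H : ℝ) ^ d * (d * (Real.log A + Real.log H)) := by
    rw [hL, ← hBcard, ← nsmul_eq_mul, ← Real.log_mul hA'.ne' hH'.ne', ← Real.log_pow]
    refine sum_le_card_nsmul _ _ _ fun x hx => Real.log_le_log ?_ ?_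
    · have h1 := (hc x hx).1
      exact_mod_cast lt_of_lt_of_le (by positivity) h1
    · exact_mod_cast (hc x hx).2
  set T := ∑ q ∈ Icc 1 Y, normVonMangoldt (𝓞 K) q / q
  have hHd : (0 : ℝ) < (H : ℝ) ^ d := by positivity
  rw [abs_le] at hmain ⊢
  have hlA := mul_nonneg (Nat.cast_nonneg (α := ℝ) d) (Real.log_natCast_nonneg A)
  constructor
  · have : (H : ℝ) ^ d * (d * Real.log H) ≤
        H ^ d * (T + C * (d * ((Real.log 4 + 4) * (A * d)))) := by linarith
    have := le_of_mul_le_mul_left this hHd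
    linarith
  · have : (H : ℝ) ^ d * T ≤ H ^ d * (d * (Real.log A + Real.log H) +
        C * (d * ((Real.log 4 + 4) * (A * d)))) := by linarith
    have := le_of_mul_le_mul_left this hHd
    linarith

/-- Mertens' theorem for prime ideal powers of a number field. -/
theorem exists_abs_sum_normVonMangoldt_sub_log_le :
    ∃ C : ℝ, ∀ N : ℕ, 1 ≤ N →
      |∑ q ∈ Icc 1 N, normVonMangoldt (𝓞 K) q / q - Real.log N| ≤ C := by
  classical
  obtain ⟨A, hA, C, hC, hT⟩ := exists_abs_sum_normVonMangoldt_pow_sub_le K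
  set d := Module.finrank ℚ K with hd
  have hd0 : 0 < d := Module.finrank_pos
  have hA' : (1 : ℝ) ≤ A := by exact_mod_cast hA
  set T : ℕ → ℝ := fun N => ∑ q ∈ Icc 1 N, normVonMangoldt (𝓞 K) q / q with hTdef
  have hmono : Monotone T := fun m n hmn =>
    sum_le_sum_of_subset_of_nonneg (Icc_subset_Icc_right hmn) fun q _ _ =>
      div_nonneg (normVonMangoldt_nonneg q) (by positivity)
  have hT0 : ∀ N, 0 ≤ T N := fun N => sum_nonneg fun q _ =>
    div_nonneg (normVonMangoldt_nonneg q) (by positivity)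
  have hlogA := Real.log_nonneg hA'
  have hlog2 : 0 ≤ Real.log 2 := Real.log_nonneg (by norm_num)
  refine ⟨C + d * Real.log 2 + d * Real.log A, fun N hN => ?_⟩
  have hN' : (1 : ℝ) ≤ N := by exact_mod_cast hN
  have hex : ∃ H, N ≤ (A * H) ^ d := ⟨N, (Nat.le_mul_of_pos_left N hA).trans
    (Nat.le_self_pow hd0.ne' _)⟩
  obtain ⟨H, hH⟩ : ∃ H, Nat.find hex = H + 1 := by
    refine Nat.exists_eq_succ_of_ne_zero fun h0 => ?_
    have := Nat.find_spec hex
    rw [h0, mul_zero, zero_pow hd0.ne'] at this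
    omega
  have hH1 : N ≤ (A * (H + 1)) ^ d := hH ▸ Nat.find_spec hex
  have hH2 : (A * H) ^ d < N := not_le.1 (Nat.find_min hex (by omega))
  have hlogN : Real.log N ≤ d * (Real.log A + Real.log (H + 1)) := by
    rw [← Real.log_mul (by positivity) (by positivity), ← Real.log_pow]
    exact Real.log_le_log (by positivity) (by exact_mod_cast hH1)
  have hlog0 := Real.log_nonneg hN'
  have hdA : 0 ≤ d * Real.log A := by positivity
  have hd2 : 0 ≤ d * Real.log 2 := by positivity
  have h1 := abs_le.1 (hT (H + 1) (by omega))
  push_cast at h1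
  have h3 := hmono hH1
  change |T N - Real.log N| ≤ _
  rw [abs_le]
  rcases Nat.eq_zero_or_pos H with rfl | hHpos
  · simp only [Nat.cast_zero, zero_add, Real.log_one, mul_zero, add_zero] at h1 hlogN
    have := hT0 N
    constructor
    · linarith
    · simp only [hTdef, zero_add] at h3 h1 ⊢
      linarith
  · have hHr : (1 : ℝ) ≤ H := by exact_mod_cast hHpos
    have h2 := abs_le.1 (hT H hHpos)
    have h4 := hmono hH2.le
    have h5 : Real.log (H + 1) ≤ Real.log 2 + Real.log H := by
      rw [← Real.log_mul (by norm_num) (by positivity)]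
      exact Real.log_le_log (by positivity) (by linarith)
    have h6 : d * Real.log (H + 1) ≤ d * Real.log 2 + d * Real.log H := by
      rw [← mul_add]
      gcongr
    have h7 : d * (Real.log A + Real.log H) ≤ Real.log N := by
      rw [← Real.log_mul (by positivity) (by positivity), ← Real.log_pow]
      exact Real.log_le_log (by positivity) (by exact_mod_cast hH2.le)
    rw [mul_add] at h7 hlogN
    simp only [hTdef] at h3 h4 ⊢
    constructor <;> linarith

end MertensNumberField

section Counting

open Finset

/-- The squarefree numbers at most `Y` all of whose prime factors lie in `P` and are at most `z`. -/
noncomputable def smoothProducts (P : Set ℕ) (z Y : ℕ) : Finset ℕ :=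
  open scoped Classical in
  {m ∈ Icc 1 Y | Squarefree m ∧ ∀ q : ℕ, q.Prime → q ∣ m → q ∈ P ∧ q ≤ z}

theorem mem_smoothProducts {P : Set ℕ} {z Y m : ℕ} :
    m ∈ smoothProducts P z Y ↔
      (1 ≤ m ∧ m ≤ Y) ∧ Squarefree m ∧ ∀ q : ℕ, q.Prime → q ∣ m → q ∈ P ∧ q ≤ z := by
  simp [smoothProducts]

theorem mul_mem_smoothProducts {P : Set ℕ} {z Y m p z' Y' : ℕ} (hm : m ∈ smoothProducts P z Y)
    (hp : p.Prime) (hpP : p ∈ P) (hzp : z < p) (hpz : p ≤ z') (hY : m * p ≤ Y') :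
    m * p ∈ smoothProducts P z' Y' := by
  rw [mem_smoothProducts] at hm ⊢
  obtain ⟨⟨hm1, hmY⟩, hsq, hq⟩ := hm
  have hpm : ¬ p ∣ m := fun h => absurd (hq p hp h).2 (by omega)
  refine ⟨⟨Nat.mul_pos hm1 hp.pos, hY⟩, ?_, fun q hqp hqd => ?_⟩
  · rw [Nat.squarefree_mul ((hp.coprime_iff_not_dvd.2 hpm).symm)]
    exact ⟨hsq, hp.prime.irreducible.squarefree⟩
  · rcases hqp.dvd_mul.1 hqd with h | h
    · exact ⟨(hq q hqp h).1, by have := (hq q hqp h).2; omega⟩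
    · rw [(Nat.prime_dvd_prime_iff_eq hqp hp).1 h]
      exact ⟨hpP, hpz⟩

theorem mul_injOn_smoothProducts {P : Set ℕ} {z Y m m' p p' : ℕ}
    (hm' : m' ∈ smoothProducts P z Y) (hp : p.Prime) (hp' : p'.Prime) (hzp : z < p)
    (h : m * p = m' * p') : m = m' ∧ p = p' := by
  rw [mem_smoothProducts] at hm'
  have h1 : p ∣ m' * p' := h ▸ dvd_mul_left p m
  rcases hp.dvd_mul.1 h1 with h2 | h2
  · exact absurd (hm'.2.2 p hp h2).2 (by omega)
  · have h3 := (Nat.prime_dvd_prime_iff_eq hp hp').1 h2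
    subst h3
    exact ⟨Nat.eq_of_mul_eq_mul_right hp.pos h, rfl⟩

open scoped Classical in
/-- Primes of `P` are not too sparse: `∑ log p / p ≥ 1` over every `p ∈ P ∩ (N, B N]`. -/
def HasLogDensity (P : Set ℕ) (B : ℕ) : Prop :=
  ∀ N : ℕ, 1 ≤ N → 1 ≤ ∑ p ∈ Ioc N (B * N) with p ∈ P, Real.log p / p

variable {P : Set ℕ} {B : ℕ}

open scoped Classical in
theorem HasLogDensity.le_card (h : HasLogDensity P B) {N : ℕ} (hN : 1 ≤ N) (hB : 2 ≤ B) :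
    (N : ℝ) / Real.log (B * N) ≤ #{p ∈ Ioc N (B * N) | p ∈ P} := by
  have hN' : (1 : ℝ) ≤ N := by exact_mod_cast hN
  have hB' : (2 : ℝ) ≤ B := by exact_mod_cast hB
  have hlog : 0 < Real.log (B * N) := Real.log_pos (by nlinarith)
  have h1 : ∑ p ∈ Ioc N (B * N) with p ∈ P, Real.log p / p ≤
      #{p ∈ Ioc N (B * N) | p ∈ P} • (Real.log (B * N) / N) := by
    refine sum_le_card_nsmul _ _ _ fun p hp => ?_
    rw [mem_filter, mem_Ioc] at hp
    have hp1 : (N : ℝ) ≤ p := by exact_mod_cast hp.1.1.le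
    have hp2 : (p : ℝ) ≤ B * N := by exact_mod_cast hp.1.2
    gcongr
    linarith
  have h2 := (h N hN).trans h1
  rw [nsmul_eq_mul, mul_div_assoc', le_div_iff₀ (by linarith), one_mul] at h2
  rwa [div_le_iff₀ hlog]

open scoped Classical in
theorem HasLogDensity.le_sum_inv (h : HasLogDensity P B) {N : ℕ} (hN : 1 ≤ N) (hB : 2 ≤ B) :
    1 / Real.log (B * N) ≤ ∑ p ∈ Ioc N (B * N) with p ∈ P, (1 / p : ℝ) := by
  have hN' : (1 : ℝ) ≤ N := by exact_mod_cast hN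
  have hB' : (2 : ℝ) ≤ B := by exact_mod_cast hB
  have hlog : 0 < Real.log (B * N) := Real.log_pos (by nlinarith)
  rw [div_le_iff₀ hlog, sum_mul]
  refine (h N hN).trans (sum_le_sum fun p hp => ?_)
  rw [mem_filter, mem_Ioc] at hp
  have hp1 : (1 : ℝ) ≤ p := by exact_mod_cast hN.trans hp.1.1.le
  have hp2 : (p : ℝ) ≤ B * N := by exact_mod_cast hp.1.2
  rw [div_mul_eq_mul_div, one_mul]
  gcongr

open scoped Classical in
theorem HasLogDensity.le_sum_inv_pow (h : HasLogDensity P B) (hB : 2 ≤ B) {k : ℕ} (hk : 1 ≤ k) :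
    1 / (2 * Real.log B) ≤ ∑ p ∈ Ioc (B ^ k) (B ^ (2 * k)) with p ∈ P, (1 / p : ℝ) := by
  have hB' : (2 : ℝ) ≤ B := by exact_mod_cast hB
  have hlog : 0 < Real.log B := Real.log_pos (by linarith)
  have key : ∀ j ≤ k, j • (1 / (2 * k * Real.log B)) ≤
      ∑ p ∈ Ioc (B ^ k) (B ^ (k + j)) with p ∈ P, (1 / p : ℝ) := by
    intro j
    induction j with
    | zero => simp
    | succ j ih =>
      intro hj
      have hsplit : ({p ∈ Ioc (B ^ k) (B ^ (k + (j + 1))) | p ∈ P} : Finset ℕ) =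
          {p ∈ Ioc (B ^ k) (B ^ (k + j)) | p ∈ P} ∪
          {p ∈ Ioc (B ^ (k + j)) (B * B ^ (k + j)) | p ∈ P} := by
        rw [← filter_union, Ioc_union_Ioc_eq_Ioc, ← pow_succ', add_assoc]
        · exact Nat.pow_le_pow_right (by omega) (by omega)
        · exact Nat.le_mul_of_pos_left _ (by omega)
      rw [hsplit, sum_union, succ_nsmul]
      · refine add_le_add (ih (by omega))
            (le_trans ?_ (h.le_sum_inv (Nat.one_le_pow _ _ (by omega)) hB))
        have h1 : (B : ℝ) * ((B ^ (k + j) : ℕ) : ℝ) = B ^ (k + j + 1) := by push_cast; ring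
        rw [h1, Real.log_pow]
        have h2 : ((k + j + 1 : ℕ) : ℝ) ≤ 2 * k := by exact_mod_cast (by omega : k + j + 1 ≤ 2 * k)
        gcongr
      · rw [disjoint_left]
        intro p hp hp'
        rw [mem_filter, mem_Ioc] at hp hp'
        omega
  have := key k le_rfl
  rw [← two_mul, nsmul_eq_mul] at this
  refine le_trans (le_of_eq ?_) this
  have : (k : ℝ) ≠ 0 := by positivity
  field_simp

theorem HasLogDensity.le_sum_smoothProducts (h : HasLogDensity P B) (hP : ∀ p ∈ P, p.Prime)
    (hB : 2 ≤ B) (i : ℕ) :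
    (1 + 1 / (2 * Real.log B)) ^ i ≤
      ∑ m ∈ smoothProducts P (B ^ 2 ^ i) (B ^ 2 ^ (i + 1)), (1 / m : ℝ) := by
  classical
  have hB' : (2 : ℝ) ≤ B := by exact_mod_cast hB
  have hlog : 0 < Real.log B := Real.log_pos (by linarith)
  induction i with
  | zero =>
    have h1 : 1 ∈ smoothProducts P (B ^ 2 ^ 0) (B ^ 2 ^ (0 + 1)) := by
      rw [mem_smoothProducts]
      refine ⟨⟨le_rfl, Nat.one_le_pow _ _ (by omega)⟩, squarefree_one, fun q hq hq1 => ?_⟩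
      exact absurd (Nat.dvd_one.1 hq1) hq.ne_one
    have h2 := single_le_sum (f := fun m : ℕ => (1 / m : ℝ)) (fun m _ => by positivity) h1
    simpa using h2
  | succ i ih =>
    set S := smoothProducts P (B ^ 2 ^ i) (B ^ 2 ^ (i + 1)) with hS
    set S' := smoothProducts P (B ^ 2 ^ (i + 1)) (B ^ 2 ^ (i + 1 + 1)) with hS'
    set T : Finset ℕ := {p ∈ Ioc (B ^ 2 ^ i) (B ^ (2 * 2 ^ i)) | p ∈ P} with hT
    have hT' : ∀ p ∈ T, p.Prime ∧ p ∈ P ∧ B ^ 2 ^ i < p ∧ p ≤ B ^ 2 ^ (i + 1) := by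
      intro p hp
      rw [hT, mem_filter, mem_Ioc] at hp
      exact ⟨hP p hp.2, hp.2, hp.1.1, by rw [pow_succ']; exact hp.1.2⟩
    have hmono : ∀ j, B ^ 2 ^ j ≤ B ^ 2 ^ (j + 1) := fun j =>
      Nat.pow_le_pow_right (by omega) (Nat.pow_le_pow_right (by omega) (by omega))
    have hinj : Set.InjOn (fun x : ℕ × ℕ => x.1 * x.2) (S ×ˢ T : Finset (ℕ × ℕ)) := by
      rintro ⟨m, p⟩ hx ⟨m', p'⟩ hx' hxx
      simp only [coe_product, Set.mem_prod, mem_coe] at hx hx'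
      have := mul_injOn_smoothProducts hx'.1 (hT' p hx.2).1 (hT' p' hx'.2).1
        (hT' p hx.2).2.2.1 hxx
      exact Prod.ext this.1 this.2
    have hdisj : Disjoint S ((S ×ˢ T).image fun x => x.1 * x.2) := by
      rw [disjoint_left]
      intro m hm hm'
      obtain ⟨⟨a, p⟩, hap, rfl⟩ := mem_image.1 hm'
      rw [mem_product] at hap
      obtain ⟨h1, -, h3, -⟩ := hT' p hap.2
      have := (mem_smoothProducts.1 hm).2.2 p h1 (dvd_mul_left _ _)
      omega
    have hsub : S ∪ (S ×ˢ T).image (fun x => x.1 * x.2) ⊆ S' := by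
      refine union_subset (fun m hm => ?_) fun m hm => ?_
      · rw [mem_smoothProducts] at hm ⊢
        exact ⟨⟨hm.1.1, hm.1.2.trans (hmono _)⟩, hm.2.1, fun q hq hqm =>
          ⟨(hm.2.2 q hq hqm).1, (hm.2.2 q hq hqm).2.trans (hmono _)⟩⟩
      · obtain ⟨⟨a, p⟩, hap, rfl⟩ := mem_image.1 hm
        rw [mem_product] at hap
        obtain ⟨h1, h2, h3, h4⟩ := hT' p hap.2
        refine mul_mem_smoothProducts hap.1 h1 h2 h3 h4 ?_
        rw [pow_succ 2 (i + 1), mul_two, pow_add]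
        exact Nat.mul_le_mul (mem_smoothProducts.1 hap.1).1.2 h4
    calc (1 + 1 / (2 * Real.log B)) ^ (i + 1)
        = (1 + 1 / (2 * Real.log B)) ^ i * (1 + 1 / (2 * Real.log B)) := pow_succ _ _
      _ ≤ (∑ m ∈ S, (1 / m : ℝ)) * (1 + ∑ p ∈ T, (1 / p : ℝ)) := by
          gcongr
          exact h.le_sum_inv_pow hB Nat.one_le_two_pow
      _ = ∑ m ∈ S, (1 / m : ℝ) + ∑ x ∈ S ×ˢ T, (1 / (x.1 * x.2 : ℕ) : ℝ) := by
          rw [mul_add, mul_one, sum_mul_sum, ← sum_product']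
          simp only [Nat.cast_mul, one_div, mul_inv]
      _ = ∑ m ∈ S ∪ (S ×ˢ T).image (fun x => x.1 * x.2), (1 / m : ℝ) := by
          rw [sum_union hdisj, sum_image hinj]
      _ ≤ ∑ m ∈ S', (1 / m : ℝ) := sum_le_sum_of_subset_of_nonneg hsub fun _ _ _ => by positivity

theorem HasLogDensity.le_card_squarefree (h : HasLogDensity P B) (hP : ∀ p ∈ P, p.Prime)
    (hB : 2 ≤ B) {i X : ℕ} (hX : B ^ (2 ^ (i + 2) + 1) ≤ X) :
    (X : ℝ) * (1 + 1 / (2 * Real.log B)) ^ i / (2 * B * Real.log X) ≤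
      #(smoothProducts P X X) := by
  classical
  have hB' : (2 : ℝ) ≤ B := by exact_mod_cast hB
  set S := smoothProducts P (B ^ 2 ^ i) (B ^ 2 ^ (i + 1)) with hS
  set T : ℕ → Finset ℕ := fun m => {p ∈ Ioc (X / (B * m)) (B * (X / (B * m))) | p ∈ P} with hT
  have hX1 : 1 < X := by
    refine lt_of_lt_of_le (Nat.one_lt_pow (Nat.succ_ne_zero _) (by omega)) hX
  have hlogX : 0 < Real.log X := Real.log_pos (by exact_mod_cast hX1)
  have hm1 : ∀ m ∈ S, 1 ≤ m := fun m hm => (mem_smoothProducts.1 hm).1.1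
  have hN : ∀ m ∈ S, B ^ 2 ^ i ≤ X / (B * m) := by
    intro m hm
    rw [Nat.le_div_iff_mul_le (Nat.mul_pos (by omega) (hm1 m hm))]
    refine le_trans ?_ hX
    calc B ^ 2 ^ i * (B * m) ≤ B ^ 2 ^ i * (B * B ^ 2 ^ (i + 1)) := by
          have := (mem_smoothProducts.1 hm).1.2
          gcongr
      _ = B ^ (2 ^ i + 2 ^ (i + 1) + 1) := by ring
      _ ≤ _ := Nat.pow_le_pow_right (by omega) (by rw [pow_add, pow_add]; omega)
  have hN1 : ∀ m ∈ S, 1 ≤ X / (B * m) := fun m hm =>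
    (Nat.one_le_pow _ _ (by omega)).trans (hN m hm)
  have hT' : ∀ m ∈ S, ∀ p ∈ T m, p.Prime ∧ p ∈ P ∧ B ^ 2 ^ i < p ∧ m * p ≤ X := by
    intro m hm p hp
    rw [hT, mem_filter, mem_Ioc] at hp
    refine ⟨hP p hp.2, hp.2, (hN m hm).trans_lt hp.1.1, ?_⟩
    calc m * p ≤ m * (B * (X / (B * m))) := Nat.mul_le_mul_left _ hp.1.2
      _ = (B * m) * (X / (B * m)) := by ring
      _ ≤ X := Nat.mul_div_le _ _
  have hcard : ∑ m ∈ S, #(T m) ≤ #(smoothProducts P X X) := by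
    rw [← card_sigma]
    refine card_le_card_of_injOn (fun x : (_ : ℕ) × ℕ => x.1 * x.2) ?_ ?_
    · rintro ⟨m, p⟩ hx
      rw [mem_coe, mem_sigma] at hx
      obtain ⟨h1, h2, h3, h4⟩ := hT' m hx.1 p hx.2
      exact mul_mem_smoothProducts hx.1 h1 h2 h3 
        ((Nat.le_mul_of_pos_left _ (hm1 m hx.1)).trans h4) h4
    · rintro ⟨m, p⟩ hx ⟨m', p'⟩ hx' hxx
      rw [mem_coe, mem_sigma] at hx hx'
      have h1 := hT' m hx.1 p hx.2
      have h2 := hT' m' hx'.1 p' hx'.2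
      obtain ⟨rfl, rfl⟩ := mul_injOn_smoothProducts hx'.1 h1.1 h2.1 h1.2.2.1 hxx
      rfl
  calc (X : ℝ) * (1 + 1 / (2 * Real.log B)) ^ i / (2 * B * Real.log X)
      ≤ X * (∑ m ∈ S, (1 / m : ℝ)) / (2 * B * Real.log X) := by
        gcongr
        exact h.le_sum_smoothProducts hP hB i
    _ = ∑ m ∈ S, X / (2 * B * m) / Real.log X := by
        rw [mul_sum, sum_div]
        refine sum_congr rfl fun m hm => ?_
        have : (m : ℝ) ≠ 0 := by have := hm1 m hm; positivity
        field_simp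
    _ ≤ ∑ m ∈ S, (#(T m) : ℝ) := by
        refine sum_le_sum fun m hm => ?_
        have hm0 : (0 : ℝ) < m := by exact_mod_cast hm1 m hm
        have h1 := hN1 m hm
        have h1' : (1 : ℝ) ≤ (X / (B * m) : ℕ) := by exact_mod_cast h1
        refine le_trans ?_ (h.le_card h1 hB)
        have h2 : X < B * m * (X / (B * m) + 1) :=
          Nat.lt_mul_div_succ _ (Nat.mul_pos (by omega) (hm1 m hm))
        have h3 : (X : ℝ) / (2 * B * m) ≤ (X / (B * m) : ℕ) := by
          rw [div_le_iff₀ (by positivity)]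
          have h2' : (X : ℝ) < B * m * ((X / (B * m) : ℕ) + 1) := by exact_mod_cast h2
          have h4 : (B : ℝ) * m * ((X / (B * m) : ℕ) + 1) ≤
            B * m * ((X / (B * m) : ℕ) + (X / (B * m) : ℕ)) := by gcongr
          linarith
        have h5 : (B : ℝ) * (X / (B * m) : ℕ) ≤ X := by
          have : B * (X / (B * m)) ≤ X := 
            (Nat.mul_le_mul_right _ (Nat.le_mul_of_pos_right _ (hm1 m hm))).trans 
              (Nat.mul_div_le X (B * m))
          exact_mod_cast this
        have h6 : 0 < Real.log (B * (X / (B * m) : ℕ)) := Real.log_pos (by nlinarith)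
        gcongr
    _ ≤ _ := by exact_mod_cast hcard

theorem HasLogDensity.exists_le_card_squarefree (h : HasLogDensity P B) (hP : ∀ p ∈ P, p.Prime)
    (hB : 3 ≤ B) :
    ∃ γ : ℝ, 0 ≤ γ ∧ γ < 1 ∧ ∃ c : ℝ, 0 < c ∧ ∃ X₀ : ℕ, ∀ X : ℕ, X₀ ≤ X →
      c * X / Real.log X ^ γ ≤ #(smoothProducts P X X) := by
  have hB' : (3 : ℝ) ≤ B := by exact_mod_cast hB
  have hlog1 : 1 < Real.log B := by
    rw [Real.lt_log_iff_exp_lt (by linarith)]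
    exact Real.exp_one_lt_three.trans_le hB'
  set δ := 1 / (2 * Real.log B) with hδ
  have hδ0 : 0 < δ := by positivity
  have hδ1 : δ < 1 := by
    rw [hδ, div_lt_one (by positivity)]
    linarith
  set η := Real.logb 2 (1 + δ) with hη
  have hη0 : 0 < η := Real.logb_pos (by norm_num) (by linarith)
  have hη1 : η ≤ 1 := by
    rw [hη, Real.logb_le_iff_le_rpow (by norm_num) (by linarith), Real.rpow_one]
    linarith
  refine ⟨1 - η, by linarith, by linarith, 1 / (16 * Real.log B) ^ η / (2 * B), by positivity,
    B ^ (2 ^ 2 + 1), fun X hX => ?_⟩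
  have hex : ∃ i, X < B ^ (2 ^ (i + 2) + 1) := by
    refine ⟨X, lt_of_lt_of_le Nat.lt_two_pow_self ?_⟩
    refine (Nat.pow_le_pow_left (by omega : 2 ≤ B) X).trans (Nat.pow_le_pow_right (by omega) ?_)
    have : X < 2 ^ X := Nat.lt_two_pow_self
    rw [pow_add]
    omega
  classical
  obtain ⟨i, hi⟩ : ∃ i, Nat.find hex = i + 1 := by
    refine Nat.exists_eq_succ_of_ne_zero fun h0 => ?_
    have := Nat.find_spec hex
    rw [h0, zero_add] at this
    omega
  have hi1 : B ^ (2 ^ (i + 2) + 1) ≤ X := not_lt.1 (Nat.find_min hex (by omega))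
  have hi2 : X < B ^ (2 ^ (i + 1 + 2) + 1) := hi ▸ Nat.find_spec hex
  have hX1 : 1 < X := lt_of_lt_of_le (Nat.one_lt_pow (Nat.succ_ne_zero _) (by omega)) hX
  have hlogX : 0 < Real.log X := Real.log_pos (by exact_mod_cast hX1)
  refine le_trans ?_ (h.le_card_squarefree hP (by omega) hi1)
  have h1 : Real.log X / (16 * Real.log B) ≤ 2 ^ i := by
    have h2 : Real.log X ≤ Real.log ((B : ℝ) ^ (2 ^ (i + 1 + 2) + 1)) :=
      Real.log_le_log (by positivity) (by exact_mod_cast hi2.le)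
    rw [Real.log_pow] at h2
    rw [div_le_iff₀ (by positivity)]
    refine h2.trans ?_
    have h3 : (((2 ^ (i + 1 + 2) + 1 : ℕ)) : ℝ) ≤ 2 ^ i * 16 := by
      have h4 : 2 ^ (i + 1 + 2) + 1 ≤ 2 ^ i * 16 := by
        have : 0 < 2 ^ i := by positivity
        rw [pow_add, pow_add]
        omega
      exact_mod_cast h4
    nlinarith
  have h2 : (Real.log X / (16 * Real.log B)) ^ η ≤ (1 + δ) ^ i := by
    refine (Real.rpow_le_rpow (by positivity) h1 hη0.le).trans (le_of_eq ?_)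
    rw [← Real.rpow_natCast, ← Real.rpow_mul (by norm_num), mul_comm, Real.rpow_mul (by norm_num),
      hη, Real.rpow_logb (by norm_num) (by norm_num) (by linarith), Real.rpow_natCast]
  calc 1 / (16 * Real.log B) ^ η / (2 * B) * X / Real.log X ^ (1 - η)
      = X * (Real.log X / (16 * Real.log B)) ^ η / (2 * B * Real.log X) := by
        rw [Real.rpow_sub hlogX, Real.rpow_one, Real.div_rpow hlogX.le (by positivity)]
        have : (16 * Real.log B) ^ η ≠ 0 := by positivity
        have : Real.log X ^ η ≠ 0 := by positivity
        field_simp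
    _ ≤ _ := by gcongr

end Counting

section DegreeOnePrimes

open NumberField

theorem exists_numberField_roots (f g : ℤ[X]) (hf : 0 < f.natDegree) (hg : 0 < g.natDegree) :
    ∃ (K : Type) (_ : Field K) (_ : NumberField K) (β ζ : K), aeval β f = 0 ∧ aeval ζ g = 0 := by
  have hroot : ∀ h : ℤ[X], 0 < h.natDegree → ∃ z : ℂ, aeval z h = 0 := fun h hh =>
    IsAlgClosed.exists_aeval_eq_zero_of_injective ℂ Int.cast_injective h
      (natDegree_pos_iff_degree_pos.1 hh).ne'
  have hisInt : ∀ h : ℤ[X], 0 < h.natDegree → ∀ z : ℂ, aeval z h = 0 → IsIntegral ℚ z := by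
    intro h hh z hz
    refine IsAlgebraic.isIntegral ⟨h.map (algebraMap ℤ ℚ), ?_, by rwa [aeval_map_algebraMap]⟩
    rw [Ne, Polynomial.map_eq_zero_iff Int.cast_injective]
    rintro rfl
    simp at hh
  obtain ⟨β, hβ⟩ := hroot f hf
  obtain ⟨ζ, hζ⟩ := hroot g hg
  set L := IntermediateField.adjoin ℚ ({β, ζ} : Set ℂ) with hL
  have hfin : FiniteDimensional ℚ L := by
    refine IntermediateField.finiteDimensional_adjoin fun x hx => ?_
    rcases hx with rfl | hx
    · exact hisInt f hf _ hβ
    · rw [Set.mem_singleton_iff.1 hx]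
      exact hisInt g hg _ hζ
  have hsub : ({β, ζ} : Set ℂ) ⊆ L := IntermediateField.subset_adjoin ℚ _
  have hdown : ∀ (h : ℤ[X]) (z : ℂ) (hz : z ∈ L), aeval z h = 0 → aeval (⟨z, hz⟩ : L) h = 0 := by
    intro h z hz h0
    apply (algebraMap L ℂ).injective
    rw [map_zero, ← aeval_algebraMap_apply]
    exact h0
  exact ⟨L, inferInstance, { to_charZero := inferInstance, to_finiteDimensional := hfin },
    ⟨β, hsub (by simp)⟩, ⟨ζ, hsub (by simp)⟩, hdown f _ _ hβ, hdown g _ _ hζ⟩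

theorem exists_ringHom_zmod_of_absNorm_eq {R : Type*} [CommRing R] [IsDedekindDomain R]
    [Module.Free ℤ R] {Q : Ideal R} {p : ℕ} [Fact p.Prime] (hQ : Ideal.absNorm Q = p) :
    Nonempty (R →+* ZMod p) := by
  have hp : p.Prime := Fact.out
  rw [Ideal.absNorm_apply, Submodule.cardQuot_apply] at hQ
  have : Finite (R ⧸ Q) := Nat.finite_of_card_ne_zero (hQ ▸ hp.ne_zero)
  have : Fintype (R ⧸ Q) := Fintype.ofFinite _
  rw [Nat.card_eq_fintype_card] at hQ
  exact ⟨(ZMod.ringEquivOfPrime (R ⧸ Q) hp hQ).symm.toRingHom.comp (Ideal.Quotient.mk Q)⟩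

theorem exists_aeval_zmod_eq_zero {K : Type*} [Field K] [NumberField K] {f : ℤ[X]}
    (hf : 0 < f.natDegree) {β : K} (hβ : aeval β f = 0) {p : ℕ} [Fact p.Prime]
    (φ : 𝓞 K →+* ZMod p) (hp : f.leadingCoeff.natAbs < p) : ∃ x : ZMod p, aeval x f = 0 := by
  have hlc : f.leadingCoeff ≠ 0 := by
    rw [Ne, leadingCoeff_eq_zero]
    rintro rfl
    simp at hf
  set γ : 𝓞 K := ⟨f.leadingCoeff • β, isIntegral_leadingCoeff_smul f β hβ⟩
  have h1 : aeval γ f.integralNormalization = 0 := by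
    apply FaithfulSMul.algebraMap_injective (𝓞 K) K
    rw [map_zero, ← aeval_algebraMap_apply]
    change aeval (f.leadingCoeff • β) f.integralNormalization = 0
    rw [zsmul_eq_mul]
    exact integralNormalization_aeval_eq_zero hβ fun x hx => by simpa using hx
  have h2 : eval₂ (Int.castRingHom (ZMod p)) (φ γ) f.integralNormalization = 0 := by
    have := congrArg φ h1
    rw [map_zero, aeval_def, hom_eval₂] at this
    rwa [RingHom.ext_int (φ.comp (algebraMap ℤ (𝓞 K))) (Int.castRingHom (ZMod p))] at this
  have h3 : (f.leadingCoeff : ZMod p) ≠ 0 := by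
    rw [Ne, ZMod.intCast_zmod_eq_zero_iff_dvd, Int.natCast_dvd]
    exact fun h => absurd (Nat.le_of_dvd (Int.natAbs_pos.2 hlc) h) (by omega)
  refine ⟨φ γ / f.leadingCoeff, ?_⟩
  have h4 := integralNormalization_eval₂_leadingCoeff_mul hf (Int.castRingHom (ZMod p))
    (φ γ / f.leadingCoeff)
  rw [eq_intCast, mul_div_cancel₀ _ h3, h2] at h4
  exact (mul_eq_zero.1 h4.symm).resolve_left (pow_ne_zero _ h3)

theorem dvd_sub_one_of_aeval_cyclotomic {K : Type*} [Field K] [NumberField K] {M : ℕ}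
    (hM : 0 < M) {ζ : K} (hζ : aeval ζ (cyclotomic M ℤ) = 0) {p : ℕ} [Fact p.Prime]
    (φ : 𝓞 K →+* ZMod p) (hp : M < p) : M ∣ p - 1 := by
  set z : 𝓞 K := ⟨ζ, cyclotomic M ℤ, cyclotomic.monic M ℤ, hζ⟩
  have h1 : aeval z (cyclotomic M ℤ) = 0 := by
    apply FaithfulSMul.algebraMap_injective (𝓞 K) K
    rw [map_zero, ← aeval_algebraMap_apply]
    exact hζ
  have h2 : (cyclotomic M (ZMod p)).IsRoot (φ z) := by
    have := congrArg φ h1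
    rw [map_zero, aeval_def, hom_eval₂] at this
    rwa [← eval_map, map_cyclotomic] at this
  have : NeZero ((M : ℕ) : ZMod p) := ⟨by
    rw [Ne, ZMod.natCast_eq_zero_iff]
    exact fun h => absurd (Nat.le_of_dvd hM h) (by omega)⟩
  rw [isRoot_cyclotomic_iff] at h2
  refine h2.dvd_of_pow_eq_one _ (ZMod.pow_card_sub_one_eq_one ?_)
  exact h2.ne_zero hM.ne'

theorem exists_hasLogDensity (K : Type*) [Field K] [NumberField K] (P : Set ℕ) (p₀ : ℕ)
    (hP : ∀ p : ℕ, p.Prime → p₀ < p → (∃ Q : Ideal (𝓞 K), Ideal.absNorm Q = p) → p ∈ P) :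
    ∃ B, 3 ≤ B ∧ HasLogDensity P B := by
  classical
  obtain ⟨C, hC⟩ := exists_abs_sum_normVonMangoldt_sub_log_le K
  set d := Module.finrank ℤ (𝓞 K)
  set u : ℕ → ℝ := fun q => (if q.Prime then 0 else ArithmeticFunction.vonMangoldt q) / q with hu
  have hu0 : ∀ q, 0 ≤ u q := by
    intro q
    have := ArithmeticFunction.vonMangoldt_nonneg (n := q)
    simp only [hu]
    split_ifs <;> positivity
  have hsum : Summable u := by
    have h1 := ArithmeticFunction.vonMangoldt.summable_residueClass_non_primes_div (0 : ZMod 1)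
    convert h1 using 3 with q
    split_ifs
    · rfl
    · rw [ArithmeticFunction.vonMangoldt.residueClass, Set.indicator_of_mem]
      exact Subsingleton.elim _ _
  set E := ∑' q, u q
  set F := ∑ q ∈ Finset.range (p₀ + 1), ArithmeticFunction.vonMangoldt q / q with hF
  obtain ⟨B, hB⟩ := exists_nat_ge (Real.exp (2 * C + d * (1 + F + E)) + 3)
  have hB3 : (3 : ℝ) ≤ B := by have := Real.exp_pos (2 * C + d * (1 + F + E)); linarith
  have hlogB : 2 * C + d * (1 + F + E) ≤ Real.log B := by
    rw [Real.le_log_iff_exp_le (by linarith)]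
    linarith
  refine ⟨B, by exact_mod_cast hB3, fun N hN => ?_⟩
  have hB1 : 1 ≤ B := by
    have : 3 ≤ B := by exact_mod_cast hB3
    omega
  have hNB : N ≤ B * N := Nat.le_mul_of_pos_left N hB1
  set s := Finset.Ioc N (B * N) with hs
  have hlow : 2 * C + d * (1 + F + E) - 2 * C ≤ ∑ q ∈ s, normVonMangoldt (𝓞 K) q / q := by
    have h1 := abs_le.1 (hC N hN)
    have h2 := abs_le.1 (hC (B * N) (hN.trans hNB))
    have h3 : Finset.Icc 1 (B * N) = Finset.Icc 1 N ∪ s := by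
      ext q
      simp only [hs, Finset.mem_union, Finset.mem_Icc, Finset.mem_Ioc]
      omega
    rw [h3, Finset.sum_union, Nat.cast_mul, Real.log_mul (by positivity) (by positivity)] at h2
    · linarith
    · rw [Finset.disjoint_left]
      intro q hq hq'
      rw [Finset.mem_Icc] at hq
      rw [hs, Finset.mem_Ioc] at hq'
      omega
  have hpt : ∀ q ∈ s, normVonMangoldt (𝓞 K) q / q ≤
      d * ((if q ∈ P then Real.log q / q else 0) +
        (if q ∈ Finset.range (p₀ + 1) then ArithmeticFunction.vonMangoldt q / q else 0) + u q) := by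
    intro q hq
    have hΛ := ArithmeticFunction.vonMangoldt_nonneg (n := q)
    have hlogq := Real.log_natCast_nonneg q
    have h1 : normVonMangoldt (𝓞 K) q / q ≤ d * (ArithmeticFunction.vonMangoldt q / q) := by
      rw [← mul_div_assoc]
      gcongr
      exact normVonMangoldt_le q
    have h2 : (0 : ℝ) ≤ if q ∈ P then Real.log q / q else 0 := by split_ifs <;> positivity
    have h3 : (0 : ℝ) ≤ if q ∈ Finset.range (p₀ + 1) then
        ArithmeticFunction.vonMangoldt q / q else 0 := by split_ifs <;> positivity
    have h4 := hu0 q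
    by_cases hqp : q.Prime
    · by_cases hq0 : q ∈ Finset.range (p₀ + 1)
      · rw [if_pos hq0] at h3 ⊢
        refine h1.trans (mul_le_mul_of_nonneg_left ?_ (by positivity))
        linarith
      · by_cases hqP : q ∈ P
        · rw [if_pos hqP] at h2 ⊢
          refine h1.trans (mul_le_mul_of_nonneg_left ?_ (by positivity))
          have h5 : ArithmeticFunction.vonMangoldt q / q ≤ Real.log q / q := by
            gcongr
            exact ArithmeticFunction.vonMangoldt_le_log
          linarith
        · have h6 : normVonMangoldt (𝓞 K) q = 0 := by
            refine Finset.sum_eq_zero fun Q hQ => ?_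
            rw [Finset.mem_range] at hq0
            exact absurd (hP q hqp (by omega) ⟨Q, mem_idealsOfNorm.1 hQ⟩) hqP
          rw [h6, zero_div]
          positivity
    · refine h1.trans (mul_le_mul_of_nonneg_left ?_ (by positivity))
      have h7 : u q = ArithmeticFunction.vonMangoldt q / q := by simp only [hu, if_neg hqp]
      linarith
  have hup := hlow.trans (Finset.sum_le_sum hpt)
  rw [← Finset.mul_sum, Finset.sum_add_distrib, Finset.sum_add_distrib, ← Finset.sum_filter,
    ← Finset.sum_filter] at hup
  have hF' : ∑ q ∈ s with q ∈ Finset.range (p₀ + 1), ArithmeticFunction.vonMangoldt q / (q : ℝ) ≤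
      F := by
    refine Finset.sum_le_sum_of_subset_of_nonneg (fun q hq => (Finset.mem_filter.1 hq).2)
      fun q _ _ => ?_
    have := ArithmeticFunction.vonMangoldt_nonneg (n := q)
    positivity
  have hE' : ∑ q ∈ s, u q ≤ E := hsum.sum_le_tsum s fun q _ => hu0 q
  have hd0 : (0 : ℝ) < d := by exact_mod_cast Module.finrank_pos
  rw [add_sub_cancel_left] at hup
  have := le_of_mul_le_mul_left hup hd0
  convert (show (1 : ℝ) ≤ ∑ q ∈ s with q ∈ P, Real.log q / q by linarith) using 1

end DegreeOnePrimes

section Twists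

theorem nthPowerFree_of_squarefree {n m : ℕ} (hn : 2 ≤ n) (hm : Squarefree m) :
    NthPowerFree n (m : ℤ) := by
  refine ⟨by exact_mod_cast hm.ne_zero, fun p hp h => ?_⟩
  have h1 : p ^ n ∣ m := by exact_mod_cast h
  have h2 : p * p ∣ m := (pow_two p ▸ pow_dvd_pow p hn).trans h1
  exact hp.one_lt.ne' (Nat.isUnit_iff.1 (hm p h2))

theorem modEq_one_of_forall_prime_modEq_one {M m : ℕ} (hm : m ≠ 0)
    (h : ∀ p : ℕ, p.Prime → p ∣ m → p ≡ 1 [MOD M]) : m ≡ 1 [MOD M] := by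
  induction m using Nat.recOnMul with
  | zero => exact absurd rfl hm
  | one => rfl
  | prime p hp => exact h p hp dvd_rfl
  | mul a b ha hb =>
    rw [mul_ne_zero_iff] at hm
    exact (ha hm.1 fun p hp hpa => h p hp (hpa.mul_right b)).mul
      (hb hm.2 fun p hp hpb => h p hp (hpb.mul_left a))

end Twists

/-- If `y^n = f(x)` is everywhere locally soluble, then `≫ X/(log X)^γ` of the
twists `d·y^n = f(x)` with `d` `n`-th power free, `|d| ≤ X`, are everywhere
locally soluble. -/
theorem stmt_5 (n : ℕ) (hn : 2 ≤ n) (f : Polynomial ℤ)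
    (hsf : Squarefree (f.map (Int.castRingHom ℚ))) (hdeg : 3 ≤ f.natDegree)
    (hls : EverywhereLocallySoluble n f 1) :
    ∃ γ : ℝ, 0 ≤ γ ∧ γ < 1 ∧ ∃ c : ℝ, 0 < c ∧ ∃ X₀ : ℝ, ∀ X : ℝ, X₀ ≤ X →
      c * X / (Real.log X) ^ γ ≤
        ({d : ℤ | |(d : ℝ)| ≤ X ∧ NthPowerFree n d ∧
            EverywhereLocallySoluble n f d}.ncard : ℝ) := by
  obtain ⟨M, hM, hMd⟩ := exists_modulus_everywhereLocallySoluble n (by omega) f hsf (by omega) hls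
  obtain ⟨K, _, _, β, ζ, hβ, hζ⟩ := exists_numberField_roots f (cyclotomic M ℤ) (by omega)
    (by rw [natDegree_cyclotomic]; exact Nat.totient_pos.2 hM)
  set P : Set ℕ := {p | p.Prime ∧ p ≡ 1 [MOD M] ∧ ∃ x : ZMod p, aeval x f = 0}
  obtain ⟨B, hB, hPB⟩ := exists_hasLogDensity K P (M + f.leadingCoeff.natAbs) (by
    rintro p hp hlt ⟨Q, hQ⟩
    have : Fact p.Prime := ⟨hp⟩
    obtain ⟨φ⟩ := exists_ringHom_zmod_of_absNorm_eq hQ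
    exact ⟨hp, ((Nat.modEq_iff_dvd' hp.one_le).2
      (dvd_sub_one_of_aeval_cyclotomic hM hζ φ (by omega))).symm,
      exists_aeval_zmod_eq_zero (by omega) hβ φ (by omega)⟩)
  obtain ⟨γ, hγ0, hγ1, c, hc, X₀, hX₀⟩ :=
    hPB.exists_le_card_squarefree (fun p hp => hp.1) hB
  refine ⟨γ, hγ0, hγ1, c / 2, by positivity, X₀ + 3, fun X hX => ?_⟩
  have hX2 : 3 ≤ X := by linarith [X₀.cast_nonneg (α := ℝ)]
  have hXX : (X₀ : ℝ) ≤ X := by linarith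
  set Y := ⌊X⌋₊
  have hYX : (Y : ℝ) ≤ X := Nat.floor_le (by linarith)
  have hXY : X < Y + 1 := Nat.lt_floor_add_one X
  have hlog : 0 < Real.log Y := Real.log_pos (by linarith)
  have hlower : c / 2 * X / Real.log X ^ γ ≤ c * Y / Real.log Y ^ γ := by
    have h1 : c / 2 * X ≤ c * Y := by nlinarith
    have h2 : Real.log Y ≤ Real.log X := Real.log_le_log (by linarith) hYX
    gcongr
  refine (hlower.trans (hX₀ Y (Nat.le_floor hXX))).trans ?_
  rw [← Finset.card_map (Nat.castEmbedding : ℕ ↪ ℤ), ← Set.ncard_coe_finset]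
  refine Nat.cast_le.2 (Set.ncard_le_ncard ?_ ?_)
  · intro d hd
    rw [Finset.mem_coe, Finset.mem_map] at hd
    obtain ⟨m, hm, rfl⟩ := hd
    obtain ⟨⟨hm1, hmY⟩, hmsf, hmP⟩ := mem_smoothProducts.1 hm
    have hmod : m ≡ 1 [MOD M] := modEq_one_of_forall_prime_modEq_one (by omega)
      fun p hp hpm => (hmP p hp hpm).1.2.1
    refine ⟨?_, nthPowerFree_of_squarefree hn hmsf, hMd m (by exact_mod_cast hm1) ?_ ?_⟩
    · have : (m : ℝ) ≤ Y := by exact_mod_cast hmY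
      simpa using this.trans hYX
    · exact_mod_cast Nat.modEq_iff_dvd.1 hmod.symm
    · exact fun p hp hpm => (hmP p hp (by exact_mod_cast hpm)).1.2.2
  · refine (Set.finite_Icc (-(Y : ℤ)) Y).subset fun d hd => ?_
    have hd' : ((d.natAbs : ℕ) : ℝ) ≤ X := by
      rw [Nat.cast_natAbs, Int.cast_abs]
      exact hd.1
    have := Nat.le_floor hd'
    rw [Set.mem_Icc]
    omega
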